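/- arXiv:1207.5363 — 2 statements merged into one kernel-verified Lean document; each statement's English description precedes it below -/
import Mathlib

section
/- Let H be a cocommutative weak Hopf algebra over a commutative ring k and A_H ↪ A an H-cleft extension with a convolution invertible total integral f: H→A. Then the map σ_A := (μ_A∘(f⊗f))∧(f^{-1}∘μ_H): H⊗H → A takes values in A_H. Moreover, with φ_{A_H}: H⊗A_H→A_H the induced weak left H-module algebra structure (the factorization of μ_A∘(A⊗(μ_A∘c_{A,A}))∘(((f⊗f^{-1})∘δ_H)⊗i_A)), the induced map σ_{A_H}: H⊗H→A_H lies in Reg_{φ_{A_H}}(H⊗H, A_H), satisfies the normal condition σ_{A_H}∘(η_H⊗H) = σ_{A_H}∘(H⊗η_H) = φ_{A_H}∘(H⊗η_{A_H}), and its convolution inverse is the factorization through A_H of σ_A^{-1} := (f∘μ_H)∧(μ_A∘c_{A,A}∘(f^{-1}⊗f^{-1})), which also takes values in A_H. -/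
open TensorProduct

noncomputable section

namespace WHA

variable (k : Type) [CommRing k]

/-- Generalized convolution product of two linear maps from a "coalgebra"
(given by a comultiplication `δC`) to a module `P` with a product `m`. -/
def convG {C P : Type} [AddCommGroup C] [Module k C] [AddCommGroup P] [Module k P]
    (δC : C →ₗ[k] C ⊗[k] C) (m : P ⊗[k] P →ₗ[k] P) (f g : C →ₗ[k] P) : C →ₗ[k] P :=
  m ∘ₗ TensorProduct.map f g ∘ₗ δC

/-- Convolution product of two linear maps from a "coalgebra" to an algebra. -/
def conv {C A : Type} [AddCommGroup C] [Module k C] [Ring A] [Algebra k A]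
    (δC : C →ₗ[k] C ⊗[k] C) (f g : C →ₗ[k] A) : C →ₗ[k] A :=
  convG k δC (LinearMap.mul' k A) f g

variable (H : Type) [Ring H] [Algebra k H]

/-- The structure maps (comultiplication, counit, antipode) of a prospective
weak Hopf algebra on the `k`-algebra `H`. -/
structure HopfData where
  δ : H →ₗ[k] H ⊗[k] H
  ε : H →ₗ[k] k
  lam : H →ₗ[k] H

variable {k H}

/-- The target map `Π^L_H = ((ε∘μ)⊗H)∘(H⊗c)∘((δ∘η)⊗H)`. -/
def PiL (W : HopfData k H) : H →ₗ[k] H :=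
  (TensorProduct.rid k H).toLinearMap
    ∘ₗ LinearMap.lTensor H (W.ε ∘ₗ LinearMap.mul' k H)
    ∘ₗ (TensorProduct.assoc k H H H).toLinearMap
    ∘ₗ LinearMap.rTensor H (TensorProduct.comm k H H).toLinearMap
    ∘ₗ TensorProduct.mk k (H ⊗[k] H) H (W.δ 1)

/-- The source map `Π^R_H = (H⊗(ε∘μ))∘(c⊗H)∘(H⊗(δ∘η))`. -/
def PiR (W : HopfData k H) : H →ₗ[k] H :=
  (TensorProduct.lid k H).toLinearMap
    ∘ₗ LinearMap.rTensor H (W.ε ∘ₗ LinearMap.mul' k H)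
    ∘ₗ (TensorProduct.assoc k H H H).symm.toLinearMap
    ∘ₗ LinearMap.lTensor H (TensorProduct.comm k H H).toLinearMap
    ∘ₗ (TensorProduct.mk k H (H ⊗[k] H)).flip (W.δ 1)

/-- `H` together with the data `W` is a weak Hopf algebra. -/
structure IsWeakHopf (W : HopfData k H) : Prop where
  coassoc : ∀ h : H,
    (TensorProduct.assoc k H H H) ((LinearMap.rTensor H W.δ) (W.δ h)) =
      (LinearMap.lTensor H W.δ) (W.δ h)
  counit_left : ∀ h : H, (TensorProduct.lid k H) ((LinearMap.rTensor H W.ε) (W.δ h)) = h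
  counit_right : ∀ h : H, (TensorProduct.rid k H) ((LinearMap.lTensor H W.ε) (W.δ h)) = h
  a1 : ∀ x y : H, W.δ (x * y) = W.δ x * W.δ y
  a2 : ∀ x y z : H, W.ε (x * y * z) =
    LinearMap.mul' k k ((TensorProduct.map (W.ε ∘ₗ LinearMap.mulLeft k x)
      (W.ε ∘ₗ LinearMap.mulRight k z)) (W.δ y))
  a2' : ∀ x y z : H, W.ε (x * y * z) =
    LinearMap.mul' k k ((TensorProduct.map (W.ε ∘ₗ LinearMap.mulLeft k x)
      (W.ε ∘ₗ LinearMap.mulRight k z)) ((TensorProduct.comm k H H) (W.δ y)))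
  a3 : (TensorProduct.assoc k H H H) ((LinearMap.rTensor H W.δ) (W.δ 1)) =
    (TensorProduct.map LinearMap.id
        (Algebra.TensorProduct.includeLeft : H →ₐ[k] H ⊗[k] H).toLinearMap) (W.δ 1) *
      (Algebra.TensorProduct.includeRight : (H ⊗[k] H) →ₐ[k] H ⊗[k] (H ⊗[k] H)).toLinearMap
        (W.δ 1)
  a3' : (TensorProduct.assoc k H H H) ((LinearMap.rTensor H W.δ) (W.δ 1)) =
    (Algebra.TensorProduct.includeRight : (H ⊗[k] H) →ₐ[k] H ⊗[k] (H ⊗[k] H)).toLinearMap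
        (W.δ 1) *
      (TensorProduct.map LinearMap.id
        (Algebra.TensorProduct.includeLeft : H →ₐ[k] H ⊗[k] H).toLinearMap) (W.δ 1)
  a4_left : ∀ h : H,
    LinearMap.mul' k H ((TensorProduct.map LinearMap.id W.lam) (W.δ h)) = PiL W h
  a4_right : ∀ h : H,
    LinearMap.mul' k H ((TensorProduct.map W.lam LinearMap.id) (W.δ h)) = PiR W h
  a4_mid : conv k W.δ (conv k W.δ W.lam LinearMap.id) W.lam = W.lam

/-- `H` is cocommutative. -/
def Cocomm (W : HopfData k H) : Prop :=
  ∀ h : H, (TensorProduct.comm k H H) (W.δ h) = W.δ h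

section ComodAlg

variable {A : Type} [Ring A] [Algebra k A]

/-- The map `ζ_A = (μ_A⊗H)∘(A⊗c_{H,A})∘((ρ_A∘η_A)⊗A)`; in the tensor product
algebra `A ⊗ H` it is given by `a ↦ ρ(1) * (a ⊗ 1)`. -/
def zeta (ρ : A →ₗ[k] A ⊗[k] H) (a : A) : A ⊗[k] H :=
  ρ 1 * (a ⊗ₜ[k] (1 : H))

/-- `a` is a coinvariant element, i.e. belongs to `A_H`. -/
def IsCoinv (ρ : A →ₗ[k] A ⊗[k] H) (a : A) : Prop :=
  ρ a = zeta ρ a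

/-- `(A, ρ)` is a right `H`-comodule algebra. -/
structure IsComodAlg (W : HopfData k H) (ρ : A →ₗ[k] A ⊗[k] H) : Prop where
  coassoc : ∀ a : A, (TensorProduct.assoc k A H H) ((LinearMap.rTensor H ρ) (ρ a)) =
    (LinearMap.lTensor A W.δ) (ρ a)
  counit : ∀ a : A, (TensorProduct.rid k A) ((LinearMap.lTensor A W.ε) (ρ a)) = a
  mul_compat : ∀ a b : A, ρ (a * b) = ρ a * ρ b
  unit_coinv : (LinearMap.lTensor A (PiL W)) (ρ 1) = ρ 1

end ComodAlg

/-- For `t = Σ x ⊗ y : B ⊗ H`, the map `h ↦ Σ ε(h*y) • x`.  For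
`t = ρ(1)` this is the map `e_A = (A⊗ε)∘Γ∘(H⊗η)`. -/
def eGen (W : HopfData k H) {B : Type} [AddCommGroup B] [Module k B]
    (t : B ⊗[k] H) : H →ₗ[k] B :=
  (TensorProduct.lid k B).toLinearMap
    ∘ₗ LinearMap.rTensor B (W.ε ∘ₗ LinearMap.mul' k H)
    ∘ₗ (TensorProduct.assoc k H H B).symm.toLinearMap
    ∘ₗ LinearMap.lTensor H (TensorProduct.comm k B H).toLinearMap
    ∘ₗ (TensorProduct.mk k H (B ⊗[k] H)).flip t

/-- For `t = Σ x ⊗ y : B ⊗ H`, the map `h ↦ Σ ε(y*h) • x`.  For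
`t = ρ(1)` this is the map `(A⊗(ε∘μ))∘((ρ∘η)⊗H)`. -/
def dGen (W : HopfData k H) {B : Type} [AddCommGroup B] [Module k B]
    (t : B ⊗[k] H) : H →ₗ[k] B :=
  (TensorProduct.rid k B).toLinearMap
    ∘ₗ LinearMap.lTensor B (W.ε ∘ₗ LinearMap.mul' k H)
    ∘ₗ (TensorProduct.assoc k B H H).toLinearMap
    ∘ₗ TensorProduct.mk k (B ⊗[k] H) H t

section ComodAlg2

variable {A : Type} [Ring A] [Algebra k A]

/-- The entwining map `Γ_A^H = (A⊗μ_H)∘(c_{H,A}⊗H)∘(H⊗ρ_A)`. -/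
def Γmap (ρ : A →ₗ[k] A ⊗[k] H) : H ⊗[k] A →ₗ[k] A ⊗[k] H :=
  LinearMap.lTensor A (LinearMap.mul' k H)
    ∘ₗ (TensorProduct.assoc k A H H).toLinearMap
    ∘ₗ LinearMap.rTensor H (TensorProduct.comm k H A).toLinearMap
    ∘ₗ (TensorProduct.assoc k H A H).symm.toLinearMap
    ∘ₗ LinearMap.lTensor H ρ

/-- `f : H → A` is an integral, i.e. a morphism of right `H`-comodules. -/
def IsIntegral (W : HopfData k H) (ρ : A →ₗ[k] A ⊗[k] H) (f : H →ₗ[k] A) : Prop :=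
  ∀ h : H, ρ (f h) = (LinearMap.rTensor H f) (W.δ h)

/-- `finv` is the convolution inverse of the integral `f` (conditions (c1)-(c3)). -/
def IsConvInv (W : HopfData k H) (ρ : A →ₗ[k] A ⊗[k] H) (f finv : H →ₗ[k] A) : Prop :=
  conv k W.δ finv f = eGen W (ρ 1) ∧
  conv k W.δ f finv = dGen W (ρ 1) ∧
  conv k W.δ (conv k W.δ finv f) finv = finv

/-- `f` is a cleaving morphism (with convolution inverse `finv`) for the extension
`A_H ↪ A`, i.e. a convolution invertible integral such that `f ∧ f⁻¹` takes
values in the coinvariants. -/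
def IsCleaving (W : HopfData k H) (ρ : A →ₗ[k] A ⊗[k] H) (f finv : H →ₗ[k] A) : Prop :=
  IsIntegral W ρ f ∧ IsConvInv W ρ f finv ∧
    ∀ h : H, IsCoinv ρ (conv k W.δ f finv h)

end ComodAlg2

section ModAlg

variable {B : Type} [Ring B] [Algebra k B]

/-- `u₁ = φ ∘ (H ⊗ η_B)`. -/
def u1 (φ : H ⊗[k] B →ₗ[k] B) : H →ₗ[k] B :=
  φ ∘ₗ (TensorProduct.mk k H B).flip 1

/-- `u₂ = u₁ ∘ μ_H`. -/
def u2 (φ : H ⊗[k] B →ₗ[k] B) : H ⊗[k] H →ₗ[k] B :=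
  u1 φ ∘ₗ LinearMap.mul' k H

/-- `(B, φ)` is a weak left `H`-module algebra (conditions (d1)-(d4)). -/
def IsWeakModAlg (W : HopfData k H) (φ : H ⊗[k] B →ₗ[k] B) : Prop :=
  (∀ b : B, φ ((1 : H) ⊗ₜ[k] b) = b) ∧
  (∀ (h : H) (b c : B), φ (h ⊗ₜ[k] (b * c)) =
    LinearMap.mul' k B ((TensorProduct.map (φ ∘ₗ (TensorProduct.mk k H B).flip b)
      (φ ∘ₗ (TensorProduct.mk k H B).flip c)) (W.δ h))) ∧
  (∀ g h : H, φ ((g * h) ⊗ₜ[k] (1 : B)) = φ (g ⊗ₜ[k] φ (h ⊗ₜ[k] (1 : B)))) ∧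
  (∀ (h : H) (b : B), φ (PiL W h ⊗ₜ[k] b) = φ (h ⊗ₜ[k] (1 : B)) * b)

/-- `(B, φ)` is a left `H`-module algebra. -/
def IsModAlg (W : HopfData k H) (φ : H ⊗[k] B →ₗ[k] B) : Prop :=
  IsWeakModAlg W φ ∧
    ∀ (g h : H) (b : B), φ ((g * h) ⊗ₜ[k] b) = φ (g ⊗ₜ[k] φ (h ⊗ₜ[k] b))

/-- `(h, hinv)` is a pair of mutually convolution inverse elements in
`Reg_{φ}(H,B)`. -/
def IsRegPair (W : HopfData k H) (φ : H ⊗[k] B →ₗ[k] B) (h hinv : H →ₗ[k] B) : Prop :=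
  conv k W.δ h hinv = u1 φ ∧ conv k W.δ hinv h = u1 φ ∧
  conv k W.δ (conv k W.δ h hinv) h = h ∧
  conv k W.δ (conv k W.δ hinv h) hinv = hinv

end ModAlg

/-- The comultiplication of the tensor product coalgebra `H ⊗ H`. -/
def δ2 (W : HopfData k H) : H ⊗[k] H →ₗ[k] (H ⊗[k] H) ⊗[k] (H ⊗[k] H) :=
  (TensorProduct.tensorTensorTensorComm k H H H H).toLinearMap
    ∘ₗ TensorProduct.map W.δ W.δ

/-- The comultiplication of the tensor product coalgebra `H ⊗ (H ⊗ H)`. -/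
def δ3 (W : HopfData k H) :
    H ⊗[k] (H ⊗[k] H) →ₗ[k] (H ⊗[k] (H ⊗[k] H)) ⊗[k] (H ⊗[k] (H ⊗[k] H)) :=
  (TensorProduct.tensorTensorTensorComm k H H (H ⊗[k] H) (H ⊗[k] H)).toLinearMap
    ∘ₗ TensorProduct.map W.δ (δ2 W)

section ModAlg2

variable {B : Type} [Ring B] [Algebra k B]

/-- `(σ, σinv)` is a pair of mutually convolution inverse elements in
`Reg_{φ}(H⊗H,B)`. -/
def IsRegPair2 (W : HopfData k H) (φ : H ⊗[k] B →ₗ[k] B)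
    (σ σinv : H ⊗[k] H →ₗ[k] B) : Prop :=
  conv k (δ2 W) σ σinv = u2 φ ∧ conv k (δ2 W) σinv σ = u2 φ ∧
  conv k (δ2 W) (conv k (δ2 W) σ σinv) σ = σ ∧
  conv k (δ2 W) (conv k (δ2 W) σinv σ) σinv = σinv

/-- Condition (g1) (the twisted condition). -/
def CrossedG1 (W : HopfData k H) (φ : H ⊗[k] B →ₗ[k] B) (σ : H ⊗[k] H →ₗ[k] B) : Prop :=
  ∀ (x y : H) (b : B),
    LinearMap.mul' k B ((TensorProduct.map σ
        ((φ ∘ₗ (TensorProduct.mk k H B).flip b) ∘ₗ LinearMap.mul' k H))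
      (δ2 W (x ⊗ₜ[k] y))) =
    LinearMap.mul' k B ((TensorProduct.map
        (φ ∘ₗ LinearMap.lTensor H (φ ∘ₗ (TensorProduct.mk k H B).flip b)) σ)
      (δ2 W (x ⊗ₜ[k] y)))

/-- Condition (g2) (the cocycle condition). -/
def CrossedG2 (W : HopfData k H) (φ : H ⊗[k] B →ₗ[k] B) (σ : H ⊗[k] H →ₗ[k] B) : Prop :=
  conv k (δ3 W) (φ ∘ₗ LinearMap.lTensor H σ)
      (σ ∘ₗ LinearMap.lTensor H (LinearMap.mul' k H)) =
  conv k (δ3 W)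
      ((TensorProduct.rid k B).toLinearMap ∘ₗ TensorProduct.map σ W.ε
        ∘ₗ (TensorProduct.assoc k H H H).symm.toLinearMap)
      (σ ∘ₗ LinearMap.rTensor H (LinearMap.mul' k H)
        ∘ₗ (TensorProduct.assoc k H H H).symm.toLinearMap)

/-- Condition (g3) (the normal condition). -/
def CrossedG3 (W : HopfData k H) (φ : H ⊗[k] B →ₗ[k] B) (σ : H ⊗[k] H →ₗ[k] B) : Prop :=
  ∀ h : H, σ (h ⊗ₜ[k] (1 : H)) = u1 φ h ∧ σ ((1 : H) ⊗ₜ[k] h) = u1 φ h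

/-- `(φ, σ)` is a crossed system for `H` over `B`, with `σinv` the convolution
inverse of `σ`. -/
def IsCrossedSystem (W : HopfData k H) (φ : H ⊗[k] B →ₗ[k] B)
    (σ σinv : H ⊗[k] H →ₗ[k] B) : Prop :=
  IsWeakModAlg W φ ∧ IsRegPair2 W φ σ σinv ∧
    CrossedG1 W φ σ ∧ CrossedG2 W φ σ ∧ CrossedG3 W φ σ

/-- The condition that `h` conjugates the weak action `ϕ` into `φ`. -/
def FisEq (W : HopfData k H) (φ ϕ : H ⊗[k] B →ₗ[k] B) (h hinv : H →ₗ[k] B) : Prop :=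
  ∀ (g : H) (b : B), φ (g ⊗ₜ[k] b) =
    (LinearMap.mul' k B ∘ₗ LinearMap.rTensor B (LinearMap.mul' k B))
      ((TensorProduct.map (TensorProduct.map h (ϕ ∘ₗ (TensorProduct.mk k H B).flip b)) hinv)
        ((LinearMap.rTensor H W.δ) (W.δ g)))

/-- The condition that `h` transforms the cocycle `τ` into `σ`. -/
def SigmasEq (W : HopfData k H) (ϕ : H ⊗[k] B →ₗ[k] B)
    (σ τ : H ⊗[k] H →ₗ[k] B) (h hinv : H →ₗ[k] B) : Prop :=
  σ = conv k (δ2 W)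
    (LinearMap.mul' k B ∘ₗ TensorProduct.map h ϕ
      ∘ₗ (TensorProduct.assoc k H H B).toLinearMap ∘ₗ TensorProduct.map W.δ h)
    (conv k (δ2 W) τ (hinv ∘ₗ LinearMap.mul' k H))

/-- `h` (with convolution inverse `hinv`) realizes an equivalence between the
crossed systems `(φ, σ)` and `(ϕ, τ)`. -/
def RealizesEquiv (W : HopfData k H) (φ ϕ : H ⊗[k] B →ₗ[k] B)
    (σ τ : H ⊗[k] H →ₗ[k] B) (h hinv : H →ₗ[k] B) : Prop :=
  IsRegPair W φ h hinv ∧ IsRegPair W ϕ h hinv ∧ h 1 = 1 ∧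
    FisEq W φ ϕ h hinv ∧ SigmasEq W ϕ σ τ h hinv

/-- The crossed systems `(φ, σ)` and `(ϕ, τ)` are equivalent. -/
def CrossedEquiv (W : HopfData k H) (φ ϕ : H ⊗[k] B →ₗ[k] B)
    (σ τ : H ⊗[k] H →ₗ[k] B) : Prop :=
  u1 φ = u1 ϕ ∧ ∃ h hinv : H →ₗ[k] B, RealizesEquiv W φ ϕ σ τ h hinv

/-- The map `ψ_H^B = (φ⊗H)∘(H⊗c_{H,B})∘(δ_H⊗B)`. -/
def ψmap (W : HopfData k H) (φ : H ⊗[k] B →ₗ[k] B) : H ⊗[k] B →ₗ[k] B ⊗[k] H :=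
  LinearMap.rTensor H φ
    ∘ₗ (TensorProduct.assoc k H B H).symm.toLinearMap
    ∘ₗ LinearMap.lTensor H (TensorProduct.comm k H B).toLinearMap
    ∘ₗ (TensorProduct.assoc k H H B).toLinearMap
    ∘ₗ LinearMap.rTensor B W.δ

/-- The map `σ_H^B = (σ⊗μ_H)∘δ_{H⊗H}`. -/
def σHA (W : HopfData k H) (σ : H ⊗[k] H →ₗ[k] B) : H ⊗[k] H →ₗ[k] B ⊗[k] H :=
  TensorProduct.map σ (LinearMap.mul' k H) ∘ₗ δ2 W

/-- The idempotent `∇_{B⊗H} = (μ_B⊗H)∘(B⊗ψ_H^B)∘(B⊗H⊗η_B)`. -/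
def nabla (W : HopfData k H) (φ : H ⊗[k] B →ₗ[k] B) : B ⊗[k] H →ₗ[k] B ⊗[k] H :=
  LinearMap.rTensor H (LinearMap.mul' k B)
    ∘ₗ (TensorProduct.assoc k B B H).symm.toLinearMap
    ∘ₗ LinearMap.lTensor B (ψmap W φ)
    ∘ₗ LinearMap.lTensor B ((TensorProduct.mk k H B).flip 1)

/-- The product `(μ_B⊗H)∘(μ_B⊗σ_H^B)∘(B⊗ψ_H^B⊗H)` on `B ⊗ H`. -/
def crossmulAmb (W : HopfData k H) (φ : H ⊗[k] B →ₗ[k] B) (σ : H ⊗[k] H →ₗ[k] B) :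
    (B ⊗[k] H) ⊗[k] (B ⊗[k] H) →ₗ[k] B ⊗[k] H :=
  LinearMap.rTensor H (LinearMap.mul' k B)
    ∘ₗ (TensorProduct.assoc k B B H).symm.toLinearMap
    ∘ₗ LinearMap.lTensor B (LinearMap.rTensor H (LinearMap.mul' k B))
    ∘ₗ LinearMap.lTensor B ((TensorProduct.assoc k B B H).symm.toLinearMap)
    ∘ₗ LinearMap.lTensor B (LinearMap.lTensor B (σHA W σ))
    ∘ₗ LinearMap.lTensor B ((TensorProduct.assoc k B H H).toLinearMap)
    ∘ₗ LinearMap.lTensor B (LinearMap.rTensor H (ψmap W φ))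
    ∘ₗ LinearMap.lTensor B ((TensorProduct.assoc k H B H).symm.toLinearMap)
    ∘ₗ (TensorProduct.assoc k B H (B ⊗[k] H)).toLinearMap

end ModAlg2

section CrossProd

variable {B : Type} [Ring B] [Algebra k B]
variable {P : Type} [AddCommGroup P] [Module k P]

/-- The product of the weak crossed product `B ×_σ H`, through a splitting
`(P, p, ι)` of the idempotent `∇_{B⊗H}`. -/
def crossMul (W : HopfData k H) (φ : H ⊗[k] B →ₗ[k] B) (σ : H ⊗[k] H →ₗ[k] B)
    (p : B ⊗[k] H →ₗ[k] P) (ι : P →ₗ[k] B ⊗[k] H) : P ⊗[k] P →ₗ[k] P :=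
  p ∘ₗ crossmulAmb W φ σ ∘ₗ TensorProduct.map ι ι

/-- The unit of the weak crossed product `B ×_σ H`. -/
def crossUnit (W : HopfData k H) (φ : H ⊗[k] B →ₗ[k] B)
    (p : B ⊗[k] H →ₗ[k] P) : P :=
  p (nabla W φ ((1 : B) ⊗ₜ[k] (1 : H)))

/-- The coaction `ρ_{B×H} = (p⊗H)∘(B⊗δ_H)∘ι` of the weak crossed product. -/
def crossCoact (W : HopfData k H)
    (p : B ⊗[k] H →ₗ[k] P) (ι : P →ₗ[k] B ⊗[k] H) : P →ₗ[k] P ⊗[k] H :=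
  LinearMap.rTensor H p ∘ₗ (TensorProduct.assoc k B H H).symm.toLinearMap
    ∘ₗ LinearMap.lTensor B W.δ ∘ₗ ι

/-- The inclusion `i_{B×H} = p∘(B⊗η_H) : B → B × H`. -/
def crossInc (p : B ⊗[k] H →ₗ[k] P) : B →ₗ[k] P :=
  p ∘ₗ (TensorProduct.mk k B H).flip 1

/-- The analogue of `ζ` for an abstract module `P` with product `m`:
`ζ(x) = t · (x ⊗ 1)` where `t` plays the role of `ρ(1)`. -/
def zetaGen (m : P ⊗[k] P →ₗ[k] P) (t : P ⊗[k] H) (x : P) : P ⊗[k] H :=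
  (TensorProduct.map m (LinearMap.mul' k H))
    ((TensorProduct.tensorTensorTensorComm k P H P H) (t ⊗ₜ[k] (x ⊗ₜ[k] (1 : H))))

end CrossProd

section Induced

variable {D P : Type} [AddCommGroup D] [Module k D] [AddCommGroup P] [Module k P]

/-- The map `(P⊗P)⊗P → P`, `(x⊗y)⊗z ↦ x·(z·y)`. -/
def mulSwizG (m : P ⊗[k] P →ₗ[k] P) : (P ⊗[k] P) ⊗[k] P →ₗ[k] P :=
  m ∘ₗ LinearMap.lTensor P (m ∘ₗ (TensorProduct.comm k P P).toLinearMap)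
    ∘ₗ (TensorProduct.assoc k P P P).toLinearMap

/-- The ambient weak action `μ∘(P⊗(μ∘c))∘(((f⊗f⁻¹)∘δ_H)⊗j) : H ⊗ D → P`
induced by a cleaving morphism `f`. -/
def phiAmb (W : HopfData k H) (m : P ⊗[k] P →ₗ[k] P) (f finv : H →ₗ[k] P)
    (j : D →ₗ[k] P) : H ⊗[k] D →ₗ[k] P :=
  mulSwizG m ∘ₗ TensorProduct.map ((TensorProduct.map f finv) ∘ₗ W.δ) j

/-- The ambient cocycle `(μ∘(f⊗f)) ∧ (f⁻¹∘μ_H) : H ⊗ H → P` induced by a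
cleaving morphism `f`. -/
def sigmaAmb (W : HopfData k H) (m : P ⊗[k] P →ₗ[k] P) (f finv : H →ₗ[k] P) :
    H ⊗[k] H →ₗ[k] P :=
  convG k (δ2 W) m (m ∘ₗ TensorProduct.map f f) (finv ∘ₗ LinearMap.mul' k H)

end Induced

section Pres

variable {A D : Type} [Ring A] [Algebra k A] [Ring D] [Algebra k D]

/-- `j : D → A` presents `D` as the subalgebra of coinvariants of `A`. -/
def IsCoinvPres (ρ : A →ₗ[k] A ⊗[k] H) (j : D →ₐ[k] A) : Prop :=
  Function.Injective j ∧ ∀ a : A, IsCoinv ρ a ↔ a ∈ Set.range j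

end Pres

section Convolution

variable {C E A B : Type} [AddCommGroup C] [Module k C]
  [AddCommGroup E] [Module k E] [Ring A] [Algebra k A] [Ring B] [Algebra k B]

theorem conv_apply (δC : C →ₗ[k] C ⊗[k] C) (u v : C →ₗ[k] A) (c : C) :
    conv k δC u v c = LinearMap.mul' k A (TensorProduct.map u v (δC c)) := rfl

/-- Convolution is associative when the comultiplication is coassociative. -/
theorem conv_assoc {δC : C →ₗ[k] C ⊗[k] C}
    (hδ : ∀ c, TensorProduct.assoc k C C C (LinearMap.rTensor C δC (δC c)) =
      LinearMap.lTensor C δC (δC c)) (u v w : C →ₗ[k] A) :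
    conv k δC (conv k δC u v) w = conv k δC u (conv k δC v w) := by
  ext c
  have hleft : ∀ s : C ⊗[k] C, LinearMap.mul' k A (TensorProduct.map (conv k δC u v) w s) =
      LinearMap.mul' k A (TensorProduct.map u (LinearMap.mul' k A ∘ₗ TensorProduct.map v w)
        (TensorProduct.assoc k C C C (LinearMap.rTensor C δC s))) := by
    intro s
    induction s with
    | zero => simp
    | add x y hx hy => simp only [map_add, hx, hy]
    | tmul a b =>
      simp only [TensorProduct.map_tmul, conv_apply, LinearMap.rTensor_tmul, LinearMap.mul'_apply]
      induction δC a with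
      | zero => simp
      | add x y hx hy => simp only [map_add, add_mul, TensorProduct.add_tmul, hx, hy]
      | tmul p q => simp [mul_assoc]
  have hright : ∀ s : C ⊗[k] C, LinearMap.mul' k A (TensorProduct.map u (conv k δC v w) s) =
      LinearMap.mul' k A (TensorProduct.map u (LinearMap.mul' k A ∘ₗ TensorProduct.map v w)
        (LinearMap.lTensor C δC s)) := by
    intro s
    rw [← LinearMap.comp_apply (TensorProduct.map _ _), LinearMap.map_comp_lTensor]
    rfl
  rw [conv_apply, conv_apply, hleft, hright, hδ]

/-- Convolution is compatible with precomposition by a comultiplicative map. -/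
theorem conv_comp {δC : C →ₗ[k] C ⊗[k] C} {δE : E →ₗ[k] E ⊗[k] E} {m : C →ₗ[k] E}
    (hm : ∀ c, δE (m c) = TensorProduct.map m m (δC c)) (u v : E →ₗ[k] A) :
    conv k δE u v ∘ₗ m = conv k δC (u ∘ₗ m) (v ∘ₗ m) := by
  ext c
  rw [LinearMap.comp_apply, conv_apply, conv_apply, hm, TensorProduct.map_comp]
  rfl

/-- Convolution is compatible with postcomposition by a multiplicative map. -/
theorem comp_conv (δC : C →ₗ[k] C ⊗[k] C) {r : A →ₗ[k] B}
    (hr : ∀ a b, r (a * b) = r a * r b) (u v : C →ₗ[k] A) :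
    r ∘ₗ conv k δC u v = conv k δC (r ∘ₗ u) (r ∘ₗ v) := by
  ext c
  rw [LinearMap.comp_apply, conv_apply, conv_apply]
  induction δC c with
  | zero => simp
  | add x y hx hy => simp only [map_add, hx, hy]
  | tmul p q => simp [hr]

theorem mulLeft_comp_conv (δC : C →ₗ[k] C ⊗[k] C) (a : A) (u v : C →ₗ[k] A) :
    LinearMap.mulLeft k a ∘ₗ conv k δC u v = conv k δC (LinearMap.mulLeft k a ∘ₗ u) v := by
  ext c
  rw [LinearMap.comp_apply, conv_apply, conv_apply]
  induction δC c with
  | zero => simp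
  | add x y hx hy => simp only [map_add, hx, hy]
  | tmul p q => simp [mul_assoc]

/-- Convolution of maps with commuting values is commutative on a cocommutative coalgebra. -/
theorem conv_comm_of_commute {δC : C →ₗ[k] C ⊗[k] C}
    (hcc : ∀ c, TensorProduct.comm k C C (δC c) = δC c) {u v : C →ₗ[k] A}
    (huv : ∀ c c', u c * v c' = v c' * u c) : conv k δC u v = conv k δC v u := by
  ext c
  rw [conv_apply, conv_apply]
  conv_rhs => rw [← hcc]
  induction δC c with
  | zero => simp
  | add x y hx hy => simp only [map_add, hx, hy]
  | tmul p q => simp [huv]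

end Convolution

section TensorSquare

variable {A : Type} [Ring A] [Algebra k A]
variable {W : HopfData k H}

theorem δ2_tmul (g h : H) : δ2 W (g ⊗ₜ[k] h) =
    TensorProduct.tensorTensorTensorComm k H H H H (W.δ g ⊗ₜ[k] W.δ h) := rfl

theorem δ2_coassoc (hW : IsWeakHopf W) (t : H ⊗[k] H) :
    TensorProduct.assoc k (H ⊗[k] H) (H ⊗[k] H) (H ⊗[k] H)
      (LinearMap.rTensor (H ⊗[k] H) (δ2 W) (δ2 W t)) =
      LinearMap.lTensor (H ⊗[k] H) (δ2 W) (δ2 W t) := by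
  let _ : Coalgebra k H :=
    { comul := W.δ
      counit := W.ε
      coassoc := LinearMap.ext hW.coassoc
      rTensor_counit_comp_comul := by
        ext h
        apply (TensorProduct.lid k H).injective
        simpa using hW.counit_left h
      lTensor_counit_comp_comul := by
        ext h
        apply (TensorProduct.rid k H).injective
        simpa using hW.counit_right h }
  exact Coalgebra.coassoc_apply (R := k) (A := H ⊗[k] H) t

theorem δ2_cocomm (hcc : Cocomm W) (t : H ⊗[k] H) :
    TensorProduct.comm k (H ⊗[k] H) (H ⊗[k] H) (δ2 W t) = δ2 W t := by
  induction t with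
  | zero => simp
  | add x y hx hy => simp only [map_add, hx, hy]
  | tmul g h =>
    rw [δ2_tmul]
    conv_rhs => rw [← hcc g, ← hcc h]
    induction W.δ g with
    | zero => simp
    | add x y hx hy => simp only [map_add, TensorProduct.add_tmul, hx, hy]
    | tmul a b =>
      induction W.δ h with
      | zero => simp
      | add x y hx hy => simp only [map_add, TensorProduct.tmul_add, hx, hy]
      | tmul c d => simp

/-- The product of `H` is comultiplicative. -/
theorem δ_mul' (hW : IsWeakHopf W) (t : H ⊗[k] H) : W.δ (LinearMap.mul' k H t) =
    TensorProduct.map (LinearMap.mul' k H) (LinearMap.mul' k H) (δ2 W t) := by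
  induction t with
  | zero => simp
  | add x y hx hy => simp only [map_add, hx, hy]
  | tmul g h =>
    rw [δ2_tmul, LinearMap.mul'_apply, hW.a1]
    induction W.δ g with
    | zero => simp
    | add x y hx hy => simp only [map_add, add_mul, TensorProduct.add_tmul, hx, hy]
    | tmul a b =>
      induction W.δ h with
      | zero => simp
      | add x y hx hy => simp only [map_add, mul_add, TensorProduct.tmul_add, hx, hy]
      | tmul c d => simp

/-- The map `H ⊗ H → H`, `g ⊗ h ↦ ε(h) g`. -/
def counitRight (W : HopfData k H) : H ⊗[k] H →ₗ[k] H :=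
  (TensorProduct.rid k H).toLinearMap ∘ₗ LinearMap.lTensor H W.ε

/-- The map `H ⊗ H → H`, `g ⊗ h ↦ ε(g) h`. -/
def counitLeft (W : HopfData k H) : H ⊗[k] H →ₗ[k] H :=
  (TensorProduct.lid k H).toLinearMap ∘ₗ LinearMap.rTensor H W.ε

@[simp] theorem counitRight_tmul (g h : H) : counitRight W (g ⊗ₜ[k] h) = W.ε h • g := by
  simp [counitRight]

@[simp] theorem counitLeft_tmul (g h : H) : counitLeft W (g ⊗ₜ[k] h) = W.ε g • h := by
  simp [counitLeft]

theorem counitRight_δ (hW : IsWeakHopf W) (h : H) : counitRight W (W.δ h) = h :=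
  hW.counit_right h

theorem counitLeft_δ (hW : IsWeakHopf W) (h : H) : counitLeft W (W.δ h) = h :=
  hW.counit_left h

theorem counit_counit_δ (hW : IsWeakHopf W) (h : H) :
    LinearMap.mul' k k (TensorProduct.map W.ε W.ε (W.δ h)) = W.ε h := by
  conv_rhs => rw [← counitRight_δ hW h]
  induction W.δ h with
  | zero => simp
  | add x y hx hy => simp only [map_add, hx, hy]
  | tmul a b => simp [mul_comm]

theorem δ_counitRight (hW : IsWeakHopf W) (t : H ⊗[k] H) : W.δ (counitRight W t) =
    TensorProduct.map (counitRight W) (counitRight W) (δ2 W t) := by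
  induction t with
  | zero => simp
  | add x y hx hy => simp only [map_add, hx, hy]
  | tmul g h =>
    rw [δ2_tmul, counitRight_tmul, map_smul, ← counit_counit_δ hW h]
    induction W.δ h with
    | zero => simp
    | add x y hx hy => simp only [map_add, add_smul, TensorProduct.tmul_add, hx, hy]
    | tmul a b =>
      induction W.δ g with
      | zero => simp
      | add x y hx hy => simp only [map_add, smul_add, TensorProduct.add_tmul, hx, hy]
      | tmul c d => simp [TensorProduct.smul_tmul', TensorProduct.tmul_smul, smul_smul, mul_comm]

theorem δ_counitLeft (hW : IsWeakHopf W) (t : H ⊗[k] H) : W.δ (counitLeft W t) =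
    TensorProduct.map (counitLeft W) (counitLeft W) (δ2 W t) := by
  induction t with
  | zero => simp
  | add x y hx hy => simp only [map_add, hx, hy]
  | tmul g h =>
    rw [δ2_tmul, counitLeft_tmul, map_smul, ← counit_counit_δ hW g]
    induction W.δ h with
    | zero => simp
    | add x y hx hy => simp only [map_add, smul_add, TensorProduct.tmul_add, hx, hy]
    | tmul a b =>
      induction W.δ g with
      | zero => simp
      | add x y hx hy => simp only [map_add, add_smul, TensorProduct.add_tmul, hx, hy]
      | tmul c d => simp [TensorProduct.smul_tmul', TensorProduct.tmul_smul, smul_smul, mul_comm]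

theorem conv_comp_counitRight_apply (hW : IsWeakHopf W) (K : H ⊗[k] H →ₗ[k] A) (v : H →ₗ[k] A)
    (g h : H) : conv k (δ2 W) K (v ∘ₗ counitRight W) (g ⊗ₜ[k] h) =
      LinearMap.mul' k A (TensorProduct.map (K ∘ₗ (TensorProduct.mk k H H).flip h) v (W.δ g)) := by
  rw [conv_apply, δ2_tmul]
  conv_rhs => rw [← counitRight_δ hW h]
  induction W.δ g with
  | zero => simp
  | add x y hx hy => simp only [map_add, TensorProduct.add_tmul, hx, hy]
  | tmul a b =>
    induction W.δ h with
    | zero => simp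
    | add x y hx hy =>
      simp only [map_add, TensorProduct.tmul_add, hx, hy]
      simp [add_mul]
    | tmul c d => simp

theorem comp_counitLeft_conv_apply (hW : IsWeakHopf W) (K : H ⊗[k] H →ₗ[k] A) (v : H →ₗ[k] A)
    (g h : H) : conv k (δ2 W) (v ∘ₗ counitLeft W) K (g ⊗ₜ[k] h) =
      LinearMap.mul' k A (TensorProduct.map v (K ∘ₗ TensorProduct.mk k H H g) (W.δ h)) := by
  rw [conv_apply, δ2_tmul]
  conv_rhs => rw [← counitLeft_δ hW g]
  induction W.δ h with
  | zero => simp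
  | add x y hx hy => simp only [map_add, TensorProduct.tmul_add, hx, hy]
  | tmul a b =>
    induction W.δ g with
    | zero => simp
    | add x y hx hy =>
      simp only [map_add, TensorProduct.add_tmul, hx, hy]
      simp [mul_add]
    | tmul c d => simp

theorem comp_counitRight_conv_comp_counitLeft (hW : IsWeakHopf W) (u v : H →ₗ[k] A) :
    conv k (δ2 W) (u ∘ₗ counitRight W) (v ∘ₗ counitLeft W) =
      LinearMap.mul' k A ∘ₗ TensorProduct.map u v := by
  apply TensorProduct.ext'
  intro g h
  rw [conv_apply, δ2_tmul, LinearMap.comp_apply]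
  conv_rhs => rw [← counitRight_δ hW g, ← counitLeft_δ hW h]
  induction W.δ g with
  | zero => simp
  | add x y hx hy => simp only [map_add, TensorProduct.add_tmul, hx, hy]
  | tmul a b =>
    induction W.δ h with
    | zero => simp
    | add x y hx hy => simp only [map_add, TensorProduct.tmul_add, hx, hy]
    | tmul c d => simp [smul_smul, mul_comm]

theorem comp_counitLeft_conv_comp_counitRight (hW : IsWeakHopf W) (u v : H →ₗ[k] A) :
    conv k (δ2 W) (v ∘ₗ counitLeft W) (u ∘ₗ counitRight W) =
      LinearMap.mul' k A ∘ₗ (TensorProduct.comm k A A).toLinearMap ∘ₗ TensorProduct.map u v := by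
  apply TensorProduct.ext'
  intro g h
  rw [conv_apply, δ2_tmul, LinearMap.comp_apply]
  conv_rhs => rw [← counitLeft_δ hW g, ← counitRight_δ hW h]
  induction W.δ g with
  | zero => simp
  | add x y hx hy => simp only [map_add, TensorProduct.add_tmul, hx, hy]
  | tmul a b =>
    induction W.δ h with
    | zero => simp
    | add x y hx hy => simp only [map_add, TensorProduct.tmul_add, hx, hy]
    | tmul c d => simp [smul_smul, mul_comm]

end TensorSquare

section Contraction

variable {A : Type} [Ring A] [Algebra k A] {W : HopfData k H}

@[simp] theorem eGen_tmul (a : A) (y h : H) :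
    eGen W (a ⊗ₜ[k] y) h = W.ε (h * y) • a := by
  simp [eGen]

@[simp] theorem dGen_tmul (a : A) (y h : H) :
    dGen W (a ⊗ₜ[k] y) h = W.ε (y * h) • a := by
  simp [dGen]

@[simp] theorem eGen_zero : eGen W (0 : A ⊗[k] H) = 0 := by
  ext
  simp [eGen]

@[simp] theorem dGen_zero : dGen W (0 : A ⊗[k] H) = 0 := by
  ext
  simp [dGen]

theorem eGen_add (s t : A ⊗[k] H) : eGen W (s + t) = eGen W s + eGen W t := by
  ext
  simp [eGen]

theorem dGen_add (s t : A ⊗[k] H) : dGen W (s + t) = dGen W s + dGen W t := by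
  ext
  simp [dGen]

theorem mul'_map_id_eGen (s t : A ⊗[k] H) :
    LinearMap.mul' k A (TensorProduct.map LinearMap.id (eGen W t) s) =
      TensorProduct.rid k A (LinearMap.lTensor A W.ε (s * t)) := by
  induction s with
  | zero => simp
  | add x y hx hy => simp only [map_add, add_mul, hx, hy]
  | tmul a y =>
    induction t with
    | zero => simp
    | add x y hx hy =>
      simp only [map_add, mul_add, ← hx, ← hy]
      simp [eGen_add, mul_add]
    | tmul b z => simp

theorem mul'_map_dGen_id (s t : A ⊗[k] H) :
    LinearMap.mul' k A
        (TensorProduct.map (dGen W t) LinearMap.id (TensorProduct.comm k A H s)) =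
      TensorProduct.rid k A (LinearMap.lTensor A W.ε (t * s)) := by
  induction s with
  | zero => simp
  | add x y hx hy => simp only [map_add, mul_add, hx, hy]
  | tmul a y =>
    induction t with
    | zero => simp
    | add x y hx hy =>
      simp only [map_add, add_mul, ← hx, ← hy]
      simp [dGen_add, add_mul]
    | tmul b z => simp

/-- `Π^L` applied to the second leg, expressed through `eGen`. -/
theorem lTensor_PiL (s : A ⊗[k] H) :
    LinearMap.lTensor A (PiL W) s = TensorProduct.map (eGen W s) LinearMap.id (W.δ 1) := by
  induction s with
  | zero => simp
  | add x y hx hy => simp only [map_add, eGen_add, TensorProduct.map_add_left, LinearMap.add_apply,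
      hx, hy]
  | tmul a y =>
    rw [LinearMap.lTensor_tmul]
    simp only [PiL, LinearMap.comp_apply, TensorProduct.mk_apply]
    induction W.δ 1 with
    | zero => simp
    | add x y hx hy => simp only [map_add, TensorProduct.add_tmul, TensorProduct.tmul_add, hx, hy]
    | tmul p q => simp [TensorProduct.smul_tmul]

theorem eGen_mul (hW : IsWeakHopf W) (t : A ⊗[k] H) (g h : H) :
    eGen W t (g * h) = LinearMap.mul' k A (TensorProduct.map (eGen W t)
      (Algebra.linearMap k A ∘ₗ W.ε ∘ₗ LinearMap.mulLeft k g) (W.δ h)) := by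
  induction t with
  | zero => simp
  | add x y hx hy => simp only [eGen_add, TensorProduct.map_add_left, LinearMap.add_apply, map_add,
      hx, hy]
  | tmul a y =>
    rw [eGen_tmul, hW.a2']
    induction W.δ h with
    | zero => simp
    | add x y hx hy => simp only [map_add, add_smul, hx, hy]
    | tmul p q => simp [Algebra.algebraMap_eq_smul_one, smul_smul]

end Contraction

section ComoduleAlgebra

variable {A : Type} [Ring A] [Algebra k A] {W : HopfData k H} {ρ : A →ₗ[k] A ⊗[k] H}

/-- `e_A(g) a = a₍₀₎ ε(g a₍₁₎)`. -/
theorem eGen_coaction (hW : IsWeakHopf W) (hρ : IsComodAlg W ρ) (a : A) (g : H) :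
    eGen W (ρ a) g = eGen W (ρ 1) g * a := by
  let Θ : A ⊗[k] (H ⊗[k] H) →ₗ[k] A :=
    (TensorProduct.rid k A).toLinearMap ∘ₗ LinearMap.lTensor A W.ε ∘ₗ
      LinearMap.mulRight k (ρ a) ∘ₗ (TensorProduct.rid k (A ⊗[k] H)).toLinearMap ∘ₗ
      LinearMap.lTensor (A ⊗[k] H) (W.ε ∘ₗ LinearMap.mulLeft k g) ∘ₗ
      (TensorProduct.assoc k A H H).symm.toLinearMap
  have hδ : ∀ t : A ⊗[k] H, eGen W (t * ρ a) g = Θ (LinearMap.lTensor A W.δ t) := by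
    intro t
    induction t with
    | zero => simp
    | add x y hx hy => simp only [map_add, add_mul, eGen_add, LinearMap.add_apply, hx, hy]
    | tmul x y =>
      simp only [Θ, LinearMap.comp_apply, LinearEquiv.coe_coe, LinearMap.lTensor_tmul]
      induction ρ a with
      | zero => simp
      | add s t hs ht =>
        rw [mul_add, eGen_add, LinearMap.add_apply, hs, ht]
        simp [mul_add]
      | tmul b z =>
        rw [Algebra.TensorProduct.tmul_mul_tmul, eGen_tmul, ← mul_assoc, hW.a2']
        induction W.δ y with
        | zero => simp
        | add s t hs ht => simp only [map_add, add_smul, TensorProduct.tmul_add, hs, ht]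
        | tmul p q => simp [smul_smul]
  have hco : ∀ t : A ⊗[k] H,
      Θ (TensorProduct.assoc k A H H (LinearMap.rTensor H ρ t)) = eGen W t g * a := by
    intro t
    induction t with
    | zero => simp
    | add x y hx hy => simp only [map_add, add_mul, eGen_add, LinearMap.add_apply, hx, hy]
    | tmul x y => simp [Θ, ← hρ.mul_compat, hρ.counit]
  conv_lhs => rw [← one_mul a, hρ.mul_compat, hδ, ← hρ.coassoc, hco]

/-- `a₍₀₎ ⊗ Π^L(a₍₁₎) = ρ(1) (a ⊗ 1)`. -/
theorem lTensor_PiL_coaction (hW : IsWeakHopf W) (hρ : IsComodAlg W ρ) (a : A) :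
    LinearMap.lTensor A (PiL W) (ρ a) = zeta ρ a := by
  rw [zeta, ← hρ.unit_coinv, lTensor_PiL, lTensor_PiL]
  have h : eGen W (ρ a) = LinearMap.mulRight k a ∘ₗ eGen W (ρ 1) := by
    ext g
    exact eGen_coaction hW hρ a g
  rw [h]
  induction W.δ 1 with
  | zero => simp
  | add x y hx hy => simp only [map_add, add_mul, hx, hy]
  | tmul p q => simp

end ComoduleAlgebra

section ComoduleMap

variable {C A : Type} [AddCommGroup C] [Module k C] [Ring A] [Algebra k A]
variable {W : HopfData k H} {ρ : A →ₗ[k] A ⊗[k] H}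
variable {δC : C →ₗ[k] C ⊗[k] C} {m : C →ₗ[k] H}

theorem conv_eGen_comp (hρ : IsComodAlg W ρ) {F : C →ₗ[k] A}
    (hF : ∀ c, ρ (F c) = TensorProduct.map F m (δC c)) :
    conv k δC F (eGen W (ρ 1) ∘ₗ m) = F := by
  ext c
  have h := mul'_map_id_eGen (W := W) (ρ (F c)) (ρ 1)
  rw [← hρ.mul_compat, mul_one, hρ.counit, hF] at h
  rw [conv_apply, ← h, TensorProduct.map_map]
  rfl

theorem dGen_comp_conv (hρ : IsComodAlg W ρ) (hcc : ∀ c, TensorProduct.comm k C C (δC c) = δC c)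
    {F : C →ₗ[k] A} (hF : ∀ c, ρ (F c) = TensorProduct.map F m (δC c)) :
    conv k δC (dGen W (ρ 1) ∘ₗ m) F = F := by
  ext c
  have h := mul'_map_dGen_id (W := W) (ρ (F c)) (ρ 1)
  rw [← hρ.mul_compat, one_mul, hρ.counit, hF] at h
  rw [conv_apply, ← h]
  conv_lhs => rw [← hcc]
  induction δC c with
  | zero => simp
  | add x y hx hy => simp only [map_add, hx, hy]
  | tmul p q => simp

/-- A map `u : C → A` viewed in the first tensor factor of `A ⊗ H`. -/
def inLeft (u : C →ₗ[k] A) : C →ₗ[k] A ⊗[k] H :=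
  (Algebra.TensorProduct.includeLeft : A →ₐ[k] A ⊗[k] H).toLinearMap ∘ₗ u

/-- A map `v : C → H` viewed in the second tensor factor of `A ⊗ H`. -/
def inRight (v : C →ₗ[k] H) : C →ₗ[k] A ⊗[k] H :=
  (Algebra.TensorProduct.includeRight : H →ₐ[k] A ⊗[k] H).toLinearMap ∘ₗ v

theorem conv_inLeft (u v : C →ₗ[k] A) :
    conv k δC (inLeft (H := H) u) (inLeft v) = inLeft (conv k δC u v) :=
  (comp_conv δC (by simp) u v).symm

theorem conv_inRight (u v : C →ₗ[k] H) :
    conv k δC (inRight (A := A) u) (inRight v) = inRight (conv k δC u v) :=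
  (comp_conv δC (by simp) u v).symm

theorem conv_inLeft_inRight_apply (u : C →ₗ[k] A) (v : C →ₗ[k] H) (c : C) :
    conv k δC (inLeft u) (inRight v) c = TensorProduct.map u v (δC c) := by
  rw [conv_apply]
  induction δC c with
  | zero => simp
  | add x y hx hy => simp only [map_add, hx, hy]
  | tmul p q => simp [inLeft, inRight]

theorem conv_inRight_inLeft (hcc : ∀ c, TensorProduct.comm k C C (δC c) = δC c)
    (u : C →ₗ[k] A) (v : C →ₗ[k] H) :
    conv k δC (inRight v) (inLeft u) = conv k δC (inLeft u) (inRight v) :=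
  conv_comm_of_commute hcc (by simp [inLeft, inRight])

/-- If `f ∧ f⁻¹` is coinvariant, then `ρ(d(h)) = d(h₁) ⊗ Π^L(h₂)` for `d = f ∧ f⁻¹`. -/
theorem coaction_comp_conv (hW : IsWeakHopf W) (hcc : Cocomm W) (hρ : IsComodAlg W ρ)
    {f finv : H →ₗ[k] A} (hf : IsCleaving W ρ f finv) :
    ρ ∘ₗ conv k W.δ f finv =
      conv k W.δ (inLeft (conv k W.δ f finv)) (inRight (PiL W)) := by
  have hPi : conv k W.δ (inLeft f) (inRight (PiL W)) =
      LinearMap.mulLeft k (ρ 1) ∘ₗ inLeft f := by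
    ext h
    rw [conv_inLeft_inRight_apply]
    have h1 := lTensor_PiL_coaction hW hρ (f h)
    rw [hf.1, ← LinearMap.comp_apply, LinearMap.lTensor_comp_rTensor] at h1
    exact h1
  rw [← conv_inLeft, conv_assoc hW.coassoc, ← conv_inRight_inLeft hcc, ← conv_assoc hW.coassoc,
    hPi, ← mulLeft_comp_conv, conv_inLeft]
  ext h
  exact hf.2.2 h

/-- A map `S : C → A` is coinvariant as soon as it transports a comodule map `F`, invertible up
to `d`, to a comodule map `S ∧ F`. -/
theorem isCoinv_of_conv (hW : IsWeakHopf W) (hρ : IsComodAlg W ρ)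
    (hδ : ∀ c, TensorProduct.assoc k C C C (LinearMap.rTensor C δC (δC c)) =
      LinearMap.lTensor C δC (δC c))
    (hcc : ∀ c, TensorProduct.comm k C C (δC c) = δC c)
    (hm : ∀ c, W.δ (m c) = TensorProduct.map m m (δC c))
    {d : H →ₗ[k] A} (hd : ρ ∘ₗ d = conv k W.δ (inLeft d) (inRight (PiL W)))
    (hdcoinv : ∀ h, IsCoinv ρ (d h)) {S F Finv : C →ₗ[k] A}
    (hF : ∀ c, ρ (F c) = TensorProduct.map F m (δC c))
    (hSF : ∀ c, ρ (conv k δC S F c) = TensorProduct.map (conv k δC S F) m (δC c))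
    (hinv : conv k δC F Finv = d ∘ₗ m)
    (hSd : conv k δC S (d ∘ₗ m) = S) (hdS : conv k δC (d ∘ₗ m) S = S) (c : C) :
    IsCoinv ρ (S c) := by
  have hF' : ρ ∘ₗ F = conv k δC (inLeft F) (inRight m) := by
    ext c
    rw [conv_inLeft_inRight_apply]
    exact hF c
  have hSF' : ρ ∘ₗ conv k δC S F = conv k δC (inLeft (conv k δC S F)) (inRight m) := by
    ext c
    rw [conv_inLeft_inRight_apply]
    exact hSF c
  have hdm : ρ ∘ₗ (d ∘ₗ m) = conv k δC (inLeft (d ∘ₗ m)) (inRight (PiL W ∘ₗ m)) := by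
    rw [← LinearMap.comp_assoc, hd, conv_comp hm]
    rfl
  have hlam : conv k δC m (W.lam ∘ₗ m) = PiL W ∘ₗ m := by
    have h : conv k W.δ LinearMap.id W.lam = PiL W := LinearMap.ext hW.a4_left
    rw [← h, conv_comp hm]
    rfl
  have hcancel : ∀ X : C →ₗ[k] A ⊗[k] H,
      conv k δC (conv k δC (conv k δC X (conv k δC (inLeft F) (inRight m)))
        (inRight (W.lam ∘ₗ m))) (inLeft Finv) = conv k δC X (ρ ∘ₗ (d ∘ₗ m)) := by
    intro X
    rw [hdm, ← hinv, ← conv_inLeft, ← hlam, ← conv_inRight]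
    simp only [conv_assoc hδ]
    congr 2
    rw [conv_inRight_inLeft hcc, ← conv_assoc hδ, conv_inRight_inLeft hcc, conv_assoc hδ]
  have hS : ρ ∘ₗ S = conv k δC (inLeft S) (ρ ∘ₗ (d ∘ₗ m)) := by
    rw [comp_conv δC hρ.mul_compat, hF', ← conv_inLeft, conv_assoc hδ (inLeft S)] at hSF'
    rw [← hcancel, ← hSF', hcancel, ← comp_conv δC hρ.mul_compat, hSd]
  have hdm' : ρ ∘ₗ (d ∘ₗ m) = LinearMap.mulLeft k (ρ 1) ∘ₗ inLeft (d ∘ₗ m) := by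
    ext c
    exact hdcoinv (m c)
  have key : ρ ∘ₗ S = LinearMap.mulLeft k (ρ 1) ∘ₗ inLeft S := by
    rw [hS, hdm, ← conv_assoc hδ, conv_inLeft, hSd]
    conv_lhs => rw [← hdS, ← conv_inLeft, conv_assoc hδ, ← conv_inRight_inLeft hcc,
      ← conv_assoc hδ, ← hdm, hdm', ← mulLeft_comp_conv, conv_inLeft, hdS]
  exact LinearMap.congr_fun key c

end ComoduleMap

section Cleft

variable {A : Type} [Ring A] [Algebra k A] {W : HopfData k H} {ρ : A →ₗ[k] A ⊗[k] H}
variable {f finv : H →ₗ[k] A}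

theorem map_mul'_tensorTensorTensorComm (u v : H →ₗ[k] A) (s t : H ⊗[k] H) :
    TensorProduct.map (LinearMap.mul' k A ∘ₗ TensorProduct.map u v) (LinearMap.mul' k H)
        (TensorProduct.tensorTensorTensorComm k H H H H (s ⊗ₜ[k] t)) =
      LinearMap.rTensor H u s * LinearMap.rTensor H v t := by
  induction s with
  | zero => simp
  | add x y hx hy => simp only [map_add, add_mul, TensorProduct.add_tmul, hx, hy]
  | tmul a b =>
    induction t with
    | zero => simp
    | add x y hx hy => simp only [map_add, mul_add, TensorProduct.tmul_add, hx, hy]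
    | tmul c d => simp

/-- `g ⊗ h ↦ f(g) f(h)` is a comodule map along the product of `H`. -/
theorem coaction_mul_map (hρ : IsComodAlg W ρ) (hf : IsIntegral W ρ f) (t : H ⊗[k] H) :
    ρ ((LinearMap.mul' k A ∘ₗ TensorProduct.map f f) t) =
      TensorProduct.map (LinearMap.mul' k A ∘ₗ TensorProduct.map f f) (LinearMap.mul' k H)
        (δ2 W t) := by
  induction t with
  | zero => simp
  | add x y hx hy => simp only [map_add, hx, hy]
  | tmul g h =>
    rw [δ2_tmul, map_mul'_tensorTensorTensorComm, ← hf, ← hf, ← hρ.mul_compat]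
    simp

/-- `g ⊗ h ↦ f(g h)` is a comodule map along the product of `H`. -/
theorem coaction_comp_mul' (hW : IsWeakHopf W) (hf : IsIntegral W ρ f) (t : H ⊗[k] H) :
    ρ ((f ∘ₗ LinearMap.mul' k H) t) =
      TensorProduct.map (f ∘ₗ LinearMap.mul' k H) (LinearMap.mul' k H) (δ2 W t) := by
  rw [LinearMap.comp_apply, hf, δ_mul' hW, LinearMap.rTensor, TensorProduct.map_map]
  rfl

/-- The convolution `(μ∘c∘(f⁻¹⊗f⁻¹)) ∧ (μ∘(f⊗f))` is `e_A ∘ μ_H`. -/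
theorem conv_mul_comm_map_mul_map (hW : IsWeakHopf W) (hρ : IsComodAlg W ρ)
    (hf : IsIntegral W ρ f) (he : conv k W.δ finv f = eGen W (ρ 1)) :
    conv k (δ2 W)
        (LinearMap.mul' k A ∘ₗ (TensorProduct.comm k A A).toLinearMap ∘ₗ
          TensorProduct.map finv finv)
        (LinearMap.mul' k A ∘ₗ TensorProduct.map f f) =
      eGen W (ρ 1) ∘ₗ LinearMap.mul' k H := by
  have hassoc := δ2_coassoc hW
  let E : H ⊗[k] H →ₗ[k] A := Algebra.linearMap k A ∘ₗ W.ε ∘ₗ LinearMap.mul' k H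
  have hE : ∀ g, E ∘ₗ TensorProduct.mk k H H g =
      Algebra.linearMap k A ∘ₗ W.ε ∘ₗ LinearMap.mulLeft k g := fun g => by
    ext
    simp [E]
  have hswap : conv k (δ2 W) (eGen W (ρ 1) ∘ₗ counitRight W) (f ∘ₗ counitLeft W) =
      conv k (δ2 W) (f ∘ₗ counitLeft W) E := by
    rw [comp_counitRight_conv_comp_counitLeft hW]
    apply TensorProduct.ext'
    intro g h
    rw [comp_counitLeft_conv_apply hW, hE, LinearMap.comp_apply, TensorProduct.map_tmul,
      LinearMap.mul'_apply, ← eGen_coaction hW hρ, hf]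
    induction W.δ h with
    | zero => simp
    | add x y hx hy => simp only [map_add, eGen_add, LinearMap.add_apply, hx, hy]
    | tmul p q => simp [Algebra.algebraMap_eq_smul_one]
  rw [← comp_counitRight_conv_comp_counitLeft hW, ← comp_counitLeft_conv_comp_counitRight hW,
    conv_assoc hassoc, ← conv_assoc hassoc (finv ∘ₗ counitRight W),
    ← conv_comp (δ_counitRight hW), he, hswap, ← conv_assoc hassoc,
    ← conv_comp (δ_counitLeft hW), he]
  apply TensorProduct.ext'
  intro g h
  rw [comp_counitLeft_conv_apply hW, hE, ← eGen_mul hW]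
  rfl

/-- The convolution `(μ∘(f⊗f)) ∧ (μ∘c∘(f⁻¹⊗f⁻¹))` is `g ⊗ h ↦ f(g₁) (f ∧ f⁻¹)(h) f⁻¹(g₂)`. -/
theorem conv_mul_map_mul_comm_map_apply (hW : IsWeakHopf W) (g h : H) :
    conv k (δ2 W) (LinearMap.mul' k A ∘ₗ TensorProduct.map f f)
        (LinearMap.mul' k A ∘ₗ (TensorProduct.comm k A A).toLinearMap ∘ₗ
          TensorProduct.map finv finv) (g ⊗ₜ[k] h) =
      LinearMap.mul' k A (TensorProduct.map
        (LinearMap.mulRight k (conv k W.δ f finv h) ∘ₗ f) finv (W.δ g)) := by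
  have hassoc := δ2_coassoc hW
  rw [← comp_counitRight_conv_comp_counitLeft hW, ← comp_counitLeft_conv_comp_counitRight hW,
    conv_assoc hassoc, ← conv_assoc hassoc (f ∘ₗ counitLeft W),
    ← conv_comp (δ_counitLeft hW), ← conv_assoc hassoc,
    comp_counitRight_conv_comp_counitLeft hW, conv_comp_counitRight_apply hW]
  rfl

theorem phiAmb_tmul {D : Type} [Ring D] [Algebra k D] (j : D →ₐ[k] A) (h : H) (b : D) :
    phiAmb W (LinearMap.mul' k A) f finv j.toLinearMap (h ⊗ₜ[k] b) =
      LinearMap.mul' k A (TensorProduct.map (LinearMap.mulRight k (j b) ∘ₗ f) finv (W.δ h)) := by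
  simp only [phiAmb, mulSwizG, LinearMap.comp_apply, TensorProduct.map_tmul]
  induction W.δ h with
  | zero => simp
  | add x y hx hy => simp only [map_add, TensorProduct.add_tmul, hx, hy]
  | tmul p q => simp [mul_assoc]

/-- The cocycle `(μ∘(f⊗f)) ∧ (f⁻¹∘μ_H)` of a total integral is normal. -/
theorem conv_mul_map_comp_mul'_normal (hρ : IsComodAlg W ρ) (hf : IsIntegral W ρ f)
    (htot : f 1 = 1) (h : H) :
    conv k (δ2 W) (LinearMap.mul' k A ∘ₗ TensorProduct.map f f) (finv ∘ₗ LinearMap.mul' k H)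
        (h ⊗ₜ[k] 1) = conv k W.δ f finv h ∧
      conv k (δ2 W) (LinearMap.mul' k A ∘ₗ TensorProduct.map f f) (finv ∘ₗ LinearMap.mul' k H)
        (1 ⊗ₜ[k] h) = conv k W.δ f finv h := by
  have hsplit : ∀ g h : H, conv k (δ2 W) (LinearMap.mul' k A ∘ₗ TensorProduct.map f f)
      (finv ∘ₗ LinearMap.mul' k H) (g ⊗ₜ[k] h) =
      LinearMap.mul' k A (LinearMap.lTensor A finv (ρ (f g * f h))) := by
    intro g h
    rw [hρ.mul_compat, hf, hf, ← map_mul'_tensorTensorTensorComm, LinearMap.lTensor,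
      TensorProduct.map_map]
    rfl
  have hone : LinearMap.mul' k A (LinearMap.lTensor A finv (ρ (f h))) = conv k W.δ f finv h := by
    rw [hf, LinearMap.lTensor, LinearMap.rTensor, TensorProduct.map_map]
    rfl
  rw [hsplit, hsplit, htot, mul_one, one_mul, hone]
  exact ⟨rfl, rfl⟩

end Cleft

/-- Let `H` be a cocommutative weak Hopf algebra and
`A_H ↪ A` an `H`-cleft extension with convolution invertible total integral
`f`.  Then `σ_A = (μ_A∘(f⊗f)) ∧ (f⁻¹∘μ_H)` takes values in `A_H`, its
factorization `σ_{A_H}` lies in `Reg_{φ_{A_H}}(H⊗H, A_H)`, satisfies the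
normal condition, and its convolution inverse is the factorization of
`σ_A⁻¹ = (f∘μ_H) ∧ (μ_A∘c_{A,A}∘(f⁻¹⊗f⁻¹))`, which also takes values in
`A_H`. -/
theorem statement13 {k H A D : Type} [CommRing k] [Ring H] [Algebra k H]
    [Ring A] [Algebra k A] [Ring D] [Algebra k D]
    (W : HopfData k H) (hW : IsWeakHopf W) (hcc : Cocomm W)
    (ρ : A →ₗ[k] A ⊗[k] H) (hρ : IsComodAlg W ρ)
    (f finv : H →ₗ[k] A) (hf : IsCleaving W ρ f finv) (htot : f 1 = 1)
    (j : D →ₐ[k] A) (hj : IsCoinvPres ρ j)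
    -- `φ'` is the induced weak `H`-module algebra structure on `A_H`:
    (φ' : H ⊗[k] D →ₗ[k] D)
    (hφ' : j.toLinearMap ∘ₗ φ' = phiAmb W (LinearMap.mul' k A) f finv j.toLinearMap)
    (hφ'wma : IsWeakModAlg W φ') :
    ∀ σA σAinv : H ⊗[k] H →ₗ[k] A,
      σA = conv k (δ2 W) (LinearMap.mul' k A ∘ₗ TensorProduct.map f f)
          (finv ∘ₗ LinearMap.mul' k H) →
      σAinv = conv k (δ2 W) (f ∘ₗ LinearMap.mul' k H)
          (LinearMap.mul' k A ∘ₗ (TensorProduct.comm k A A).toLinearMap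
            ∘ₗ TensorProduct.map finv finv) →
      (∀ t : H ⊗[k] H, σA t ∈ Set.range j) ∧
      (∀ t : H ⊗[k] H, σAinv t ∈ Set.range j) ∧
      ∃ σ' σ'' : H ⊗[k] H →ₗ[k] D,
        j.toLinearMap ∘ₗ σ' = σA ∧ j.toLinearMap ∘ₗ σ'' = σAinv ∧
        IsRegPair2 W φ' σ' σ'' ∧
        (∀ h : H, σ' (h ⊗ₜ[k] (1 : H)) = u1 φ' h ∧
          σ' ((1 : H) ⊗ₜ[k] h) = u1 φ' h) := by
  intro σA σAinv hσ hτ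
  obtain ⟨hint, ⟨he, hd, hfinv⟩, hcoinv⟩ := hf
  have hassoc := δ2_coassoc hW
  have hcc2 := δ2_cocomm hcc
  have hm := δ_mul' hW
  set m := LinearMap.mul' k H
  set F := LinearMap.mul' k A ∘ₗ TensorProduct.map f f
  set Finv := LinearMap.mul' k A ∘ₗ (TensorProduct.comm k A A).toLinearMap ∘ₗ
    TensorProduct.map finv finv
  set d := conv k W.δ f finv with hd'
  have hρF : ∀ t, ρ (F t) = TensorProduct.map F m (δ2 W t) := coaction_mul_map hρ hint
  have hρG : ∀ t, ρ ((f ∘ₗ m) t) = TensorProduct.map (f ∘ₗ m) m (δ2 W t) :=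
    coaction_comp_mul' hW hint
  have hφ : ∀ h b, j (φ' (h ⊗ₜ[k] b)) = LinearMap.mul' k A
      (TensorProduct.map (LinearMap.mulRight k (j b) ∘ₗ f) finv (W.δ h)) := by
    intro h b
    rw [← phiAmb_tmul, ← hφ']
    rfl
  have hφ1 : ∀ h, j (φ' (h ⊗ₜ[k] 1)) = d h := by
    intro h
    rw [hφ, map_one, LinearMap.mulRight_one, LinearMap.id_comp]
    rfl
  have hu2 : j.toLinearMap ∘ₗ u2 φ' = d ∘ₗ m := by
    ext t
    exact hφ1 _
  have hGG : conv k (δ2 W) (f ∘ₗ m) (finv ∘ₗ m) = d ∘ₗ m := (conv_comp hm f finv).symm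
  have hGinvG : conv k (δ2 W) (finv ∘ₗ m) (f ∘ₗ m) = eGen W (ρ 1) ∘ₗ m := by
    rw [← conv_comp hm, he]
  have hFF : conv k (δ2 W) F Finv = d ∘ₗ m := by
    apply TensorProduct.ext'
    intro g h
    rw [conv_mul_map_mul_comm_map_apply hW, ← hd', ← hφ1 h, ← hφ, ← hφ'wma.2.2.1, hφ1]
    rfl
  have hFinvF : conv k (δ2 W) Finv F = eGen W (ρ 1) ∘ₗ m :=
    conv_mul_comm_map_mul_map hW hρ hint he
  have hFe : conv k (δ2 W) F (eGen W (ρ 1) ∘ₗ m) = F := conv_eGen_comp hρ hρF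
  have hGe : conv k (δ2 W) (f ∘ₗ m) (eGen W (ρ 1) ∘ₗ m) = f ∘ₗ m := conv_eGen_comp hρ hρG
  have hdF : conv k (δ2 W) (d ∘ₗ m) F = F := by rw [hd, dGen_comp_conv hρ hcc2 hρF]
  have hdG : conv k (δ2 W) (d ∘ₗ m) (f ∘ₗ m) = f ∘ₗ m := by
    rw [hd, dGen_comp_conv hρ hcc2 hρG]
  have hσG : conv k (δ2 W) σA (f ∘ₗ m) = F := by rw [hσ, conv_assoc hassoc, hGinvG, hFe]
  have hτF : conv k (δ2 W) σAinv F = f ∘ₗ m := by rw [hτ, conv_assoc hassoc, hFinvF, hGe]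
  have hστ : conv k (δ2 W) σA σAinv = d ∘ₗ m := by
    rw [hτ, ← conv_assoc hassoc, hσG, hFF]
  have hτσ : conv k (δ2 W) σAinv σA = d ∘ₗ m := by
    rw [hσ, ← conv_assoc hassoc, hτF, hGG]
  have hdσ : conv k (δ2 W) (d ∘ₗ m) σA = σA := by rw [hσ, ← conv_assoc hassoc, hdF]
  have hdτ : conv k (δ2 W) (d ∘ₗ m) σAinv = σAinv := by rw [hτ, ← conv_assoc hassoc, hdG]
  have hσd : conv k (δ2 W) σA (d ∘ₗ m) = σA := by rw [← hτσ, ← conv_assoc hassoc, hστ, hdσ]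
  have hτd : conv k (δ2 W) σAinv (d ∘ₗ m) = σAinv := by
    rw [← hστ, ← conv_assoc hassoc, hτσ, hdτ]
  have hρd := coaction_comp_conv hW hcc hρ ⟨hint, ⟨he, hd, hfinv⟩, hcoinv⟩
  have hσmem : ∀ t, σA t ∈ Set.range j := fun t => (hj.2 _).1 <|
    isCoinv_of_conv hW hρ hassoc hcc2 hm hρd hcoinv hρG (by rw [hσG]; exact hρF) hGG hσd hdσ t
  have hτmem : ∀ t, σAinv t ∈ Set.range j := fun t => (hj.2 _).1 <|
    isCoinv_of_conv hW hρ hassoc hcc2 hm hρd hcoinv hρF (by rw [hτF]; exact hρG) hFF hτd hdτ t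
  have hfactor : ∀ S : H ⊗[k] H →ₗ[k] A, (∀ t, S t ∈ Set.range j) →
      ∃ S' : H ⊗[k] H →ₗ[k] D, j.toLinearMap ∘ₗ S' = S := by
    intro S hS
    refine ⟨(LinearEquiv.ofInjective j.toLinearMap hj.1).symm.toLinearMap ∘ₗ
      S.codRestrict (LinearMap.range j.toLinearMap) hS, ?_⟩
    refine LinearMap.ext fun t => ?_
    exact congrArg Subtype.val ((LinearEquiv.ofInjective j.toLinearMap hj.1).apply_symm_apply
      (S.codRestrict (LinearMap.range j.toLinearMap) hS t))
  obtain ⟨σ', hσ'⟩ := hfactor σA hσmem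
  obtain ⟨σ'', hσ''⟩ := hfactor σAinv hτmem
  have hcancel : ∀ {u v : H ⊗[k] H →ₗ[k] D},
      j.toLinearMap ∘ₗ u = j.toLinearMap ∘ₗ v → u = v :=
    fun huv => LinearMap.ext fun t => hj.1 (LinearMap.congr_fun huv t)
  have hjconv : ∀ u v : H ⊗[k] H →ₗ[k] D, j.toLinearMap ∘ₗ conv k (δ2 W) u v =
      conv k (δ2 W) (j.toLinearMap ∘ₗ u) (j.toLinearMap ∘ₗ v) :=
    comp_conv (δ2 W) (map_mul j)
  refine ⟨hσmem, hτmem, σ', σ'', hσ', hσ'', ⟨?_, ?_, ?_, ?_⟩, fun h => ?_⟩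
  · exact hcancel (by rw [hjconv, hσ', hσ'', hστ, hu2])
  · exact hcancel (by rw [hjconv, hσ', hσ'', hτσ, hu2])
  · exact hcancel (by rw [hjconv, hjconv, hσ', hσ'', hστ, hdσ])
  · exact hcancel (by rw [hjconv, hjconv, hσ', hσ'', hτσ, hdτ])
  · have hjσ : ∀ t, j (σ' t) = σA t := LinearMap.congr_fun hσ'
    have hnormal := conv_mul_map_comp_mul'_normal (finv := finv) hρ hint htot h
    constructor
    · apply hj.1
      rw [hjσ, hσ, hnormal.1]
      exact (hφ1 h).symm
    · apply hj.1
      rw [hjσ, hσ, hnormal.2]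
      exact (hφ1 h).symm

end WHA

end
end

section
/- Let H be a cocommutative weak Hopf algebra over a commutative ring k and A_H ↪ A an H-cleft extension with a convolution invertible total integral f: H→A. Then the pair (φ_{A_H}, σ_{A_H}) (the weak left H-module algebra structure and the map induced by f) is a crossed system for H over A_H. Moreover, the H-cleft extensions A_H ↪ A and A_H ↪ A_H×_{σ_{A_H}}H are equivalent: T = p_{A_H⊗H}∘(p_A⊗H)∘ρ_A: A → A_H×_{σ_{A_H}}H is an isomorphism of right H-comodule algebras with T∘i_A = i_{A_H×_{σ_{A_H}}H}, where p_A: A→A_H is the factorization through A_H of q_A = μ_A∘(A⊗f^{-1})∘ρ_A. -/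
open TensorProduct

noncomputable section

namespace WHA

variable (k : Type) [CommRing k]

variable (H : Type) [Ring H] [Algebra k H]

variable {k H}

section Convolution

open Coalgebra WithConv

variable {k C C' C'' A : Type} [CommRing k] [AddCommGroup C] [Module k C]
  [AddCommGroup C'] [Module k C'] [AddCommGroup C''] [Module k C''] [Ring A] [Algebra k A]

/-- Precomposition with `m` on convolution algebras. -/
def pull (m : C →ₗ[k] C') (G : WithConv (C' →ₗ[k] A)) : WithConv (C →ₗ[k] A) :=
  toConv (G.ofConv ∘ₗ m)

@[simp]
lemma pull_apply (m : C →ₗ[k] C') (G : WithConv (C' →ₗ[k] A)) (c : C) :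
    (pull m G).ofConv c = G.ofConv (m c) := rfl

lemma pull_pull (m : C' →ₗ[k] C'') (n : C →ₗ[k] C') (G : WithConv (C'' →ₗ[k] A)) :
    pull n (pull m G) = pull (m ∘ₗ n) G := rfl

variable [Coalgebra k C] [Coalgebra k C'] [Coalgebra k C'']

/-- The map `m` is comultiplicative (but possibly not counital). -/
def IsComul (m : C →ₗ[k] C') : Prop :=
  comul ∘ₗ m = TensorProduct.map m m ∘ₗ comul

lemma IsComul.comp {m : C' →ₗ[k] C''} {n : C →ₗ[k] C'} (hm : IsComul m) (hn : IsComul n) :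
    IsComul (m ∘ₗ n) := by
  unfold IsComul at *
  rw [← LinearMap.comp_assoc, hm, LinearMap.comp_assoc, hn, TensorProduct.map_comp,
    LinearMap.comp_assoc]

lemma IsComul.pull_mul {m : C →ₗ[k] C'} (hm : IsComul m) (G K : WithConv (C' →ₗ[k] A)) :
    pull m (G * K) = pull m G * pull m K := by
  apply WithConv.ext
  simp only [pull, LinearMap.convMul_def, LinearMap.comp_assoc]
  rw [hm, TensorProduct.map_comp, LinearMap.comp_assoc]

lemma IsComul.map {C₁ C₂ : Type} [AddCommGroup C₁] [Module k C₁] [Coalgebra k C₁]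
    [AddCommGroup C₂] [Module k C₂] [Coalgebra k C₂] {m : C →ₗ[k] C'} {n : C₁ →ₗ[k] C₂}
    (hm : IsComul m) (hn : IsComul n) : IsComul (TensorProduct.map m n) := by
  refine TensorProduct.ext' fun x y ↦ ?_
  have hx : comul (m x) = TensorProduct.map m m (comul (R := k) x) := congr($hm x)
  have hy : comul (n y) = TensorProduct.map n n (comul (R := k) y) := congr($hn y)
  simp only [LinearMap.comp_apply, TensorProduct.map_tmul, TensorProduct.comul_tmul, hx, hy]
  induction comul (R := k) x with
  | zero => simp
  | add u v hu hv => simpa [TensorProduct.add_tmul] using congrArg₂ (· + ·) hu hv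
  | tmul x₁ x₂ =>
    induction comul (R := k) y with
    | zero => simp
    | add u v hu hv => simpa [TensorProduct.tmul_add] using congrArg₂ (· + ·) hu hv
    | tmul y₁ y₂ => simp

lemma CoalgHom.isComul (m : C →ₗc[k] C') : IsComul m.toLinearMap :=
  m.map_comp_comul.symm

/-- A scalar-valued map is central in the convolution algebra of a cocommutative coalgebra. -/
lemma pull_one_mul_comm [IsCocomm k C] (m : C →ₗ[k] C') (G : WithConv (C →ₗ[k] A)) :
    G * pull m 1 = pull m 1 * G := by
  apply WithConv.ext
  ext c
  rw [LinearMap.convMul_apply, ← comm_comul k c, LinearMap.convMul_apply]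
  induction comul (R := k) c with
  | zero => simp
  | tmul a b => simp [Algebra.commutes]
  | add u v hu hv => simpa using congrArg₂ (· + ·) hu hv

/-- The constant map `c ↦ ε(c) a`. -/
def cst (C : Type) [AddCommGroup C] [Module k C] [Coalgebra k C] (a : A) :
    WithConv (C →ₗ[k] A) :=
  toConv (LinearMap.toSpanSingleton k A a ∘ₗ counit)

@[simp]
lemma cst_apply (a : A) (c : C) : (cst (k := k) C a).ofConv c = counit (R := k) c • a := rfl

lemma sum_smul_counit (c : C) :
    ∑ i ∈ (ℛ k c).index, counit (R := k) ((ℛ k c).right i) • (ℛ k c).left i = c := by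
  simpa only [map_sum, TensorProduct.rid_tmul, one_smul] using
    congr(TensorProduct.rid k C $(sum_tmul_counit_eq (R := k) (ℛ k c)))

lemma mul_cst_apply (G : WithConv (C →ₗ[k] A)) (a : A) (c : C) :
    (G * cst C a).ofConv c = G.ofConv c * a := by
  rw [(ℛ k c).convMul_apply]
  conv_rhs => rw [← sum_smul_counit (k := k) c]
  simp [Finset.sum_mul]

lemma cst_mul_apply (G : WithConv (C →ₗ[k] A)) (a : A) (c : C) :
    (cst C a * G).ofConv c = a * G.ofConv c := by
  rw [(ℛ k c).convMul_apply]
  conv_rhs => rw [← sum_counit_smul (ℛ k c)]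
  simp [Finset.mul_sum]

/-- Projection `C ⊗ C' → C`. -/
def fstP (C C' : Type) [AddCommGroup C] [Module k C] [Coalgebra k C]
    [AddCommGroup C'] [Module k C'] [Coalgebra k C'] : C ⊗[k] C' →ₗ[k] C :=
  (TensorProduct.rid k C).toLinearMap ∘ₗ LinearMap.lTensor C counit

/-- Projection `C ⊗ C' → C'`. -/
def sndP (C C' : Type) [AddCommGroup C] [Module k C] [Coalgebra k C]
    [AddCommGroup C'] [Module k C'] [Coalgebra k C'] : C ⊗[k] C' →ₗ[k] C' :=
  (TensorProduct.lid k C').toLinearMap ∘ₗ LinearMap.rTensor C' counit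

@[simp]
lemma fstP_tmul (x : C) (y : C') : fstP C C' (x ⊗ₜ[k] y) = counit (R := k) y • x := by
  simp [fstP]

@[simp]
lemma sndP_tmul (x : C) (y : C') : sndP C C' (x ⊗ₜ[k] y) = counit (R := k) x • y := by
  simp [sndP]

lemma isComul_fstP : IsComul (fstP (k := k) C C') := by
  have : fstP (k := k) C C' = ((Coalgebra.TensorProduct.rid k k C).toCoalgHom.comp
    (Coalgebra.TensorProduct.map (CoalgHom.id k C) (counitCoalgHom k C'))).toLinearMap := by
    ext; simp
  rw [this]
  exact CoalgHom.isComul _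

lemma isComul_sndP : IsComul (sndP (k := k) C C') := by
  have : sndP (k := k) C C' = ((Coalgebra.TensorProduct.lid k C').toCoalgHom.comp
    (Coalgebra.TensorProduct.map (counitCoalgHom k C) (CoalgHom.id k C'))).toLinearMap := by
    ext; simp
  rw [this]
  exact CoalgHom.isComul _

lemma pull_fstP_mul_apply (G : WithConv (C →ₗ[k] A)) (N : WithConv (C ⊗[k] C' →ₗ[k] A))
    (x : C) (y : C') :
    (pull (fstP C C') G * N).ofConv (x ⊗ₜ[k] y) =
      LinearMap.mul' k A (TensorProduct.map G.ofConv
        (N.ofConv ∘ₗ (TensorProduct.mk k C C').flip y) (comul x)) := by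
  have hy := sum_counit_smul (ℛ k y)
  rw [LinearMap.convMul_apply, TensorProduct.comul_tmul]
  induction comul (R := k) x with
  | zero => simp
  | add u v hu hv => simpa [TensorProduct.add_tmul] using congrArg₂ (· + ·) hu hv
  | tmul x₁ x₂ =>
    conv_rhs => rw [← hy]
    rw [← (ℛ k y).eq]
    simp [TensorProduct.tmul_sum]

lemma mul_pull_sndP_apply (G : WithConv (C' →ₗ[k] A)) (N : WithConv (C ⊗[k] C' →ₗ[k] A))
    (x : C) (y : C') :
    (N * pull (sndP C C') G).ofConv (x ⊗ₜ[k] y) =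
      LinearMap.mul' k A (TensorProduct.map (N.ofConv ∘ₗ TensorProduct.mk k C C' x)
        G.ofConv (comul y)) := by
  have hx := sum_smul_counit (k := k) x
  rw [LinearMap.convMul_apply, TensorProduct.comul_tmul]
  induction comul (R := k) y with
  | zero => simp
  | add u v hu hv => simpa [TensorProduct.tmul_add] using congrArg₂ (· + ·) hu hv
  | tmul y₁ y₂ =>
    conv_rhs => rw [← hx]
    rw [← (ℛ k x).eq]
    simp [TensorProduct.sum_tmul]

lemma pull_fstP_mul_pull_sndP_apply (G : WithConv (C →ₗ[k] A)) (K : WithConv (C' →ₗ[k] A))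
    (x : C) (y : C') :
    (pull (fstP C C') G * pull (sndP C C') K).ofConv (x ⊗ₜ[k] y) = G.ofConv x * K.ofConv y := by
  rw [pull_fstP_mul_apply]
  conv_rhs => rw [← sum_smul_counit (k := k) x]
  rw [← (ℛ k x).eq]
  simp [Finset.sum_mul]

end Convolution

section CleftRelations

open Coalgebra WithConv

variable {k H A : Type} [CommRing k] [Ring H] [Algebra k H] [Coalgebra k H] [Ring A] [Algebra k A]

/-- The relations satisfied, in convolution algebras, by a total integral `f`, its convolution
inverse `g` and the maps `d = f ∧ g` and `e = g ∧ f`. -/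
structure CleftRel (f g d e : WithConv (H →ₗ[k] A)) : Prop where
  isComul_mul : IsComul (LinearMap.mul' k H)
  mul_inv : f * g = d
  inv_mul : g * f = e
  e_mul_inv : e * g = g
  mul_e : f * e = f
  fst_mul_snd_d : pull (fstP H H) f * pull (sndP H H) d =
    pull (LinearMap.mul' k H) 1 * pull (fstP H H) f
  mul_d : pull (LinearMap.mul' k H) d = pull (LinearMap.mul' k H) 1 * pull (fstP H H) d
  mul_e' : pull (LinearMap.mul' k H) e = pull (LinearMap.mul' k H) 1 * pull (sndP H H) e
  fst_e_mul_snd : pull (fstP H H) e * pull (sndP H H) f =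
    pull (LinearMap.mul' k H) 1 * pull (sndP H H) f

/-- The cocycle `(x, y) ↦ f(x) f(y) g(xy)`. -/
def cocyc (f g : WithConv (H →ₗ[k] A)) : WithConv (H ⊗[k] H →ₗ[k] A) :=
  pull (fstP H H) f * pull (sndP H H) f * pull (LinearMap.mul' k H) g

/-- The inverse cocycle `(x, y) ↦ f(xy) g(y) g(x)`. -/
def cocycInv (f g : WithConv (H →ₗ[k] A)) : WithConv (H ⊗[k] H →ₗ[k] A) :=
  pull (LinearMap.mul' k H) f * (pull (sndP H H) g * pull (fstP H H) g)

namespace CleftRel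

variable {f g d e : WithConv (H →ₗ[k] A)}

lemma d_mul (h : CleftRel f g d e) : d * f = f := by
  rw [← h.mul_inv, mul_assoc, h.inv_mul, h.mul_e]

lemma d_mul_cocycInv (h : CleftRel f g d e) :
    pull (LinearMap.mul' k H) d * cocycInv f g = cocycInv f g := by
  unfold cocycInv
  rw [← mul_assoc, ← h.isComul_mul.pull_mul, h.d_mul]

variable [IsCocomm k H]

lemma cocyc_mul_cocycInv (h : CleftRel f g d e) :
    cocyc f g * cocycInv f g = pull (LinearMap.mul' k H) d := by
  have hM := h.isComul_mul
  have hX := isComul_fstP (k := k) (C := H) (C' := H)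
  have hY := isComul_sndP (k := k) (C := H) (C' := H)
  have hE := pull_one_mul_comm (A := A) (LinearMap.mul' k H)
  unfold cocyc cocycInv
  calc _ = pull (fstP H H) f * pull (sndP H H) f * pull (LinearMap.mul' k H) (g * f) *
        (pull (sndP H H) g * pull (fstP H H) g) := by
        rw [hM.pull_mul]; simp only [mul_assoc]
    _ = pull (fstP H H) f * (pull (sndP H H) f * pull (LinearMap.mul' k H) 1) *
        pull (sndP H H) (e * g) * pull (fstP H H) g := by
        rw [h.inv_mul, h.mul_e', hY.pull_mul]; simp only [mul_assoc]
    _ = (pull (fstP H H) f * pull (LinearMap.mul' k H) 1) *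
        pull (sndP H H) (f * g) * pull (fstP H H) g := by
        rw [hE, h.e_mul_inv, hY.pull_mul]; simp only [mul_assoc]
    _ = pull (LinearMap.mul' k H) 1 * (pull (fstP H H) f *
        pull (sndP H H) d) * pull (fstP H H) g := by
        rw [hE, h.mul_inv]; simp only [mul_assoc]
    _ = pull (LinearMap.mul' k H) (1 * 1) * pull (fstP H H) (f * g) := by
        rw [h.fst_mul_snd_d, hM.pull_mul, hX.pull_mul]; simp only [mul_assoc]
    _ = _ := by rw [h.mul_inv, one_mul, h.mul_d]

lemma cocycInv_mul_cocyc (h : CleftRel f g d e) :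
    cocycInv f g * cocyc f g = pull (LinearMap.mul' k H) d := by
  have hM := h.isComul_mul
  have hX := isComul_fstP (k := k) (C := H) (C' := H)
  have hY := isComul_sndP (k := k) (C := H) (C' := H)
  have hE := pull_one_mul_comm (A := A) (LinearMap.mul' k H)
  unfold cocyc cocycInv
  calc _ = pull (LinearMap.mul' k H) f * (pull (sndP H H) g * (pull (fstP H H) (g * f) *
        pull (sndP H H) f)) * pull (LinearMap.mul' k H) g := by
        rw [hX.pull_mul]; simp only [mul_assoc]
    _ = pull (LinearMap.mul' k H) f * (pull (sndP H H) g * pull (LinearMap.mul' k H) 1) *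
        pull (sndP H H) f * pull (LinearMap.mul' k H) g := by
        rw [h.inv_mul, h.fst_e_mul_snd]; simp only [mul_assoc]
    _ = pull (LinearMap.mul' k H) f * (pull (LinearMap.mul' k H) 1 *
        pull (sndP H H) (g * f)) * pull (LinearMap.mul' k H) g := by
        rw [hE, hY.pull_mul]; simp only [mul_assoc]
    _ = pull (LinearMap.mul' k H) (f * e * g) := by
        rw [h.inv_mul, ← h.mul_e', hM.pull_mul, hM.pull_mul]
    _ = _ := by rw [h.mul_e, h.mul_inv]

lemma d_mul_cocyc (h : CleftRel f g d e) :
    pull (LinearMap.mul' k H) d * cocyc f g = cocyc f g := by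
  have hE := pull_one_mul_comm (A := A) (LinearMap.mul' k H)
  unfold cocyc
  calc _ = pull (LinearMap.mul' k H) 1 * pull (fstP H H) (d * f) * pull (sndP H H) f *
        pull (LinearMap.mul' k H) g := by
        rw [h.mul_d, isComul_fstP.pull_mul]; simp only [mul_assoc]
    _ = pull (fstP H H) f * pull (sndP H H) f * pull (LinearMap.mul' k H) (1 * g) := by
        rw [h.d_mul, h.isComul_mul.pull_mul, ← hE]
        simp only [mul_assoc]
        rw [← mul_assoc (pull (sndP H H) f), hE]
        simp only [mul_assoc]
    _ = _ := by rw [one_mul]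

/-- `f(x) b f(y) g(xy) f(xy) = f(x) b f(y)` for `b` commuting with `e`. -/
lemma fst_mul_mul_snd_mul_e (h : CleftRel f g d e) {b : WithConv (H ⊗[k] H →ₗ[k] A)}
    (hb : pull (fstP H H) e * b = b * pull (fstP H H) e) :
    pull (fstP H H) f * b * pull (sndP H H) f * pull (LinearMap.mul' k H) e =
      pull (fstP H H) f * b * pull (sndP H H) f := by
  have hX := isComul_fstP (k := k) (C := H) (C' := H)
  have hY := isComul_sndP (k := k) (C := H) (C' := H)
  have hE := pull_one_mul_comm (A := A) (LinearMap.mul' k H)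
  calc _ = pull (fstP H H) f * b * (pull (LinearMap.mul' k H) 1 * pull (sndP H H) (f * e)) := by
        rw [h.mul_e', hY.pull_mul, ← hE, ← hE]
        simp only [mul_assoc]
    _ = pull (fstP H H) f * (b * pull (fstP H H) e) * pull (sndP H H) f := by
        rw [h.mul_e, ← h.fst_e_mul_snd]; simp only [mul_assoc]
    _ = pull (fstP H H) (f * e) * b * pull (sndP H H) f := by
        rw [← hb, hX.pull_mul]; simp only [mul_assoc]
    _ = _ := by rw [h.mul_e]

/-- `g(x) · σ(x,y) = e(x) f(y) g(xy)`, multiplied on the left by `g(y)`. -/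
lemma inv_mul_inv_mul_cocyc (h : CleftRel f g d e) :
    pull (sndP H H) g * pull (fstP H H) g * cocyc f g =
      pull (sndP H H) e * pull (LinearMap.mul' k H) g := by
  have hX := isComul_fstP (k := k) (C := H) (C' := H)
  have hY := isComul_sndP (k := k) (C := H) (C' := H)
  have hE := pull_one_mul_comm (A := A) (LinearMap.mul' k H)
  unfold cocyc
  calc _ = pull (sndP H H) g * (pull (fstP H H) (g * f) * pull (sndP H H) f) *
        pull (LinearMap.mul' k H) g := by
        rw [hX.pull_mul]; simp only [mul_assoc]
    _ = pull (sndP H H) g * (pull (sndP H H) f * pull (LinearMap.mul' k H) 1) *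
        pull (LinearMap.mul' k H) g := by
        rw [h.inv_mul, h.fst_e_mul_snd, hE]
    _ = pull (sndP H H) (g * f) * pull (LinearMap.mul' k H) (1 * g) := by
        rw [hY.pull_mul, h.isComul_mul.pull_mul]; simp only [mul_assoc]
    _ = _ := by rw [h.inv_mul, one_mul]

/-- The twisted condition. -/
lemma twisted (h : CleftRel f g d e) {b : WithConv (H ⊗[k] H →ₗ[k] A)}
    (hb : pull (sndP H H) e * b = b * pull (sndP H H) e) :
    cocyc f g * (pull (LinearMap.mul' k H) f * b * pull (LinearMap.mul' k H) g) =
      pull (fstP H H) f * (pull (sndP H H) f * b * pull (sndP H H) g) * pull (fstP H H) g *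
        cocyc f g := by
  have hX := isComul_fstP (k := k) (C := H) (C' := H)
  have hY := isComul_sndP (k := k) (C := H) (C' := H)
  have hE := pull_one_mul_comm (A := A) (LinearMap.mul' k H)
  have hM := h.isComul_mul
  trans pull (fstP H H) f * pull (sndP H H) f * b * pull (LinearMap.mul' k H) g
  · have h1 := h.fst_mul_mul_snd_mul_e (b := 1) (by simp)
    rw [mul_one] at h1
    conv_rhs => rw [← h1]
    rw [← h.inv_mul, hM.pull_mul]
    simp only [cocyc, mul_assoc]
  · have h2 := h.inv_mul_inv_mul_cocyc
    calc _ = pull (fstP H H) f * pull (sndP H H) (f * e) * b * pull (LinearMap.mul' k H) g := by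
          rw [h.mul_e]
      _ = pull (fstP H H) f * pull (sndP H H) f * b *
          (pull (sndP H H) e * pull (LinearMap.mul' k H) g) := by
          have hb' (Z) : pull (sndP H H) e * (b * Z) = b * (pull (sndP H H) e * Z) := by
            rw [← mul_assoc, hb, mul_assoc]
          rw [hY.pull_mul]
          simp only [mul_assoc, hb']
      _ = _ := by rw [← h2]; simp only [mul_assoc]

/-- `f(x) b g(x) σ(x,y) f(xy) = f(x) b f(y)` for `b` commuting with `e`. -/
lemma conj_mul_cocyc_mul (h : CleftRel f g d e) {b : WithConv (H ⊗[k] H →ₗ[k] A)}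
    (hb : pull (fstP H H) e * b = b * pull (fstP H H) e) :
    pull (fstP H H) f * b * pull (fstP H H) g * cocyc f g * pull (LinearMap.mul' k H) f =
      pull (fstP H H) f * b * pull (sndP H H) f := by
  have hX := isComul_fstP (k := k) (C := H) (C' := H)
  calc _ = pull (fstP H H) f * (b * pull (fstP H H) (g * f)) * pull (sndP H H) f *
        pull (LinearMap.mul' k H) (g * f) := by
        rw [hX.pull_mul, h.isComul_mul.pull_mul]; simp only [cocyc, mul_assoc]
    _ = pull (fstP H H) (f * e) * b * pull (sndP H H) f * pull (LinearMap.mul' k H) e := by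
        rw [h.inv_mul, ← hb, hX.pull_mul]; simp only [mul_assoc]
    _ = _ := by rw [h.mul_e, h.fst_mul_mul_snd_mul_e hb]

/-- The projection of `H ⊗ (H ⊗ H)` on the first two factors. -/
def fstSndP (k H : Type) [CommRing k] [Ring H] [Algebra k H] [Coalgebra k H] :
    H ⊗[k] (H ⊗[k] H) →ₗ[k] H ⊗[k] H :=
  fstP (H ⊗[k] H) H ∘ₗ (TensorProduct.assoc k H H H).symm.toLinearMap

/-- The cocycle condition. -/
lemma cocycle (h : CleftRel f g d e) :
    pull (fstP H (H ⊗[k] H)) f * pull (sndP H (H ⊗[k] H)) (cocyc f g) *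
        pull (fstP H (H ⊗[k] H)) g *
        pull (LinearMap.lTensor H (LinearMap.mul' k H)) (cocyc f g) =
      pull (fstSndP k H) (cocyc f g) *
        pull (LinearMap.rTensor H (LinearMap.mul' k H) ∘ₗ
          (TensorProduct.assoc k H H H).symm.toLinearMap) (cocyc f g) := by
  have hM := h.isComul_mul
  have hX := isComul_fstP (k := k) (C := H) (C' := H)
  have hY := isComul_sndP (k := k) (C := H) (C' := H)
  have hx := isComul_fstP (k := k) (C := H) (C' := H ⊗[k] H)
  have hS := isComul_sndP (k := k) (C := H) (C' := H ⊗[k] H)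
  have hid : IsComul (LinearMap.id : H →ₗ[k] H) := by simp [IsComul]
  have hn : IsComul (LinearMap.lTensor H (LinearMap.mul' k H)) := hid.map hM
  have hassoc : IsComul (TensorProduct.assoc k H H H).symm.toLinearMap :=
    CoalgHom.isComul (Coalgebra.TensorProduct.assoc k k H H H).symm.toCoalgHom
  have hq : IsComul (fstSndP k H) := isComul_fstP.comp hassoc
  have hr : IsComul (LinearMap.rTensor H (LinearMap.mul' k H) ∘ₗ
      (TensorProduct.assoc k H H H).symm.toLinearMap) := (hM.map hid).comp hassoc
  have hcocyc : cocyc f g * pull (LinearMap.mul' k H) f =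
      pull (fstP H H) f * pull (sndP H H) f := by
    have h1 := h.fst_mul_mul_snd_mul_e (b := 1) (by simp)
    rw [mul_one] at h1
    conv_rhs => rw [← h1, ← h.inv_mul, hM.pull_mul]
    simp only [cocyc, mul_assoc]
  have hnX (G : WithConv (H →ₗ[k] A)) :
      pull (LinearMap.lTensor H (LinearMap.mul' k H)) (pull (fstP H H) G) =
        pull (LinearMap.mul' k H ∘ₗ sndP H (H ⊗[k] H)) 1 * pull (fstP H (H ⊗[k] H)) G := by
    rw [← pull_one_mul_comm]
    apply WithConv.ext
    refine TensorProduct.ext' fun x w ↦ ?_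
    rw [← pull_pull, pull_fstP_mul_pull_sndP_apply]
    simp only [pull_apply, LinearMap.lTensor_tmul, fstP_tmul, map_smul, LinearMap.convOne_apply]
    rw [Algebra.smul_def, Algebra.commutes]
  have hnY (G : WithConv (H →ₗ[k] A)) :
      pull (LinearMap.lTensor H (LinearMap.mul' k H)) (pull (sndP H H) G) =
        pull (sndP H (H ⊗[k] H)) (pull (LinearMap.mul' k H) G) := by
    rw [pull_pull, pull_pull]
    congr 1
    refine TensorProduct.ext' fun x w ↦ ?_
    simp
  have hqX (G : WithConv (H →ₗ[k] A)) :
      pull (fstSndP k H) (pull (fstP H H) G) = pull (fstP H (H ⊗[k] H)) G := by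
    rw [pull_pull]
    congr 1
    ext x y z
    simp [fstSndP, mul_smul]
  have hqY (G : WithConv (H →ₗ[k] A)) :
      pull (fstSndP k H) (pull (sndP H H) G) =
        pull (sndP H (H ⊗[k] H)) (pull (fstP H H) G) := by
    rw [pull_pull, pull_pull]
    congr 1
    ext x y z
    simp [fstSndP]
    exact smul_comm _ _ _
  have hrX (G : WithConv (H →ₗ[k] A)) :
      pull (LinearMap.rTensor H (LinearMap.mul' k H) ∘ₗ
        (TensorProduct.assoc k H H H).symm.toLinearMap) (pull (fstP H H) G) =
        pull (fstSndP k H) (pull (LinearMap.mul' k H) G) := by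
    rw [pull_pull, pull_pull]
    congr 1
    ext x y z
    simp [fstSndP]
  have hrY (G : WithConv (H →ₗ[k] A)) :
      pull (LinearMap.rTensor H (LinearMap.mul' k H) ∘ₗ
        (TensorProduct.assoc k H H H).symm.toLinearMap) (pull (sndP H H) G) =
        pull (fstSndP k H) (pull (LinearMap.mul' k H) 1) *
          pull (sndP H (H ⊗[k] H)) (pull (sndP H H) G) := by
    have h1 : pull (LinearMap.rTensor H (LinearMap.mul' k H)) (pull (sndP H H) G) =
        pull (fstP (H ⊗[k] H) H) (pull (LinearMap.mul' k H) 1) *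
          pull (sndP (H ⊗[k] H) H) G := by
      apply WithConv.ext
      refine TensorProduct.ext' fun w z ↦ ?_
      rw [pull_fstP_mul_pull_sndP_apply]
      simp only [pull_apply, LinearMap.rTensor_tmul, sndP_tmul, map_smul, LinearMap.convOne_apply]
      rw [Algebra.smul_def]
    rw [← pull_pull, h1, hassoc.pull_mul]
    simp only [pull_pull]
    congr 2
    ext x y z
    simp [mul_smul]
    exact smul_comm _ _ _
  have hrM (G : WithConv (H →ₗ[k] A)) :
      pull (LinearMap.rTensor H (LinearMap.mul' k H) ∘ₗ
        (TensorProduct.assoc k H H H).symm.toLinearMap) (pull (LinearMap.mul' k H) G) =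
      pull (LinearMap.lTensor H (LinearMap.mul' k H)) (pull (LinearMap.mul' k H) G) := by
    rw [pull_pull, pull_pull]
    congr 1
    ext x y z
    simp [mul_assoc]
  have hK := congrArg (pull (LinearMap.lTensor H (LinearMap.mul' k H))) h.fst_e_mul_snd
  rw [hn.pull_mul, hn.pull_mul, hnX, hnY] at hK
  trans pull (fstP H (H ⊗[k] H)) f * pull (sndP H (H ⊗[k] H)) (pull (fstP H H) f) *
    pull (sndP H (H ⊗[k] H)) (pull (sndP H H) f) *
    pull (LinearMap.lTensor H (LinearMap.mul' k H)) (pull (LinearMap.mul' k H) g)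
  · have h2 : pull (LinearMap.lTensor H (LinearMap.mul' k H)) (cocyc f g) =
        pull (LinearMap.mul' k H ∘ₗ sndP H (H ⊗[k] H)) 1 * pull (fstP H (H ⊗[k] H)) f *
          pull (sndP H (H ⊗[k] H)) (pull (LinearMap.mul' k H) f) *
          pull (LinearMap.lTensor H (LinearMap.mul' k H)) (pull (LinearMap.mul' k H) g) := by
      rw [← hnX, ← hnY, ← hn.pull_mul, ← hn.pull_mul]
      rfl
    have h3 : pull (fstP H (H ⊗[k] H)) g *
        pull (LinearMap.lTensor H (LinearMap.mul' k H)) (cocyc f g) =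
        pull (sndP H (H ⊗[k] H)) (pull (LinearMap.mul' k H) f) *
          pull (LinearMap.lTensor H (LinearMap.mul' k H)) (pull (LinearMap.mul' k H) g) := by
      calc _ = pull (LinearMap.mul' k H ∘ₗ sndP H (H ⊗[k] H)) 1 *
            pull (fstP H (H ⊗[k] H)) (g * f) *
            pull (sndP H (H ⊗[k] H)) (pull (LinearMap.mul' k H) f) *
            pull (LinearMap.lTensor H (LinearMap.mul' k H)) (pull (LinearMap.mul' k H) g) := by
            rw [h2, hx.pull_mul]
            simp only [← mul_assoc]
            rw [pull_one_mul_comm]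
        _ = _ := by
            rw [h.inv_mul, hK, pull_pull _ _ 1, ← pull_one_mul_comm, mul_assoc, ← pull_pull,
              ← hn.pull_mul, ← hM.pull_mul, one_mul]
    rw [mul_assoc, h3, mul_assoc, ← mul_assoc (pull (sndP _ _) (cocyc f g)), ← hS.pull_mul,
      hcocyc, hS.pull_mul]
    simp only [mul_assoc]
  · symm
    calc _ = pull (fstSndP k H) (cocyc f g * pull (LinearMap.mul' k H) (f * 1)) *
          pull (sndP H (H ⊗[k] H)) (pull (sndP H H) f) *
          pull (LinearMap.lTensor H (LinearMap.mul' k H)) (pull (LinearMap.mul' k H) g) := by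
          conv_lhs => rhs; rw [cocyc, hr.pull_mul, hr.pull_mul, hrX, hrY, hrM]
          rw [hM.pull_mul, hq.pull_mul, hq.pull_mul]
          simp only [mul_assoc]
      _ = _ := by rw [mul_one, hcocyc, hq.pull_mul, hqX, hqY]

end CleftRel

end CleftRelations

section Contraction

variable {k H A B : Type} [CommRing k] [Ring H] [Algebra k H] [Ring A] [Algebra k A]
  [AddCommGroup B] [Module k B] (W : HopfData k H)

/-- The map `b ⊗ g ↦ ε(gh) b`. -/
def epsRight (h : H) : B ⊗[k] H →ₗ[k] B :=
  (TensorProduct.rid k B).toLinearMap ∘ₗ LinearMap.lTensor B (W.ε ∘ₗ LinearMap.mulRight k h)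

/-- The map `b ⊗ g ↦ ε(hg) b`. -/
def epsLeft (h : H) : B ⊗[k] H →ₗ[k] B :=
  (TensorProduct.rid k B).toLinearMap ∘ₗ LinearMap.lTensor B (W.ε ∘ₗ LinearMap.mulLeft k h)

@[simp]
lemma epsRight_tmul (h g : H) (b : B) : epsRight W h (b ⊗ₜ[k] g) = W.ε (g * h) • b := by
  simp [epsRight]

@[simp]
lemma epsLeft_tmul (h g : H) (b : B) : epsLeft W h (b ⊗ₜ[k] g) = W.ε (h * g) • b := by
  simp [epsLeft]

lemma dGen_apply (t : B ⊗[k] H) (h : H) : dGen W t h = epsRight W h t := by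
  induction t with
  | zero => simp [dGen]
  | tmul b g => simp [dGen]
  | add u v hu hv => simpa [dGen, TensorProduct.add_tmul] using congrArg₂ (· + ·) hu hv

lemma eGen_apply (t : B ⊗[k] H) (h : H) : eGen W t h = epsLeft W h t := by
  induction t with
  | zero => simp [eGen]
  | tmul b g => simp [eGen]
  | add u v hu hv => simpa [eGen, TensorProduct.tmul_add] using congrArg₂ (· + ·) hu hv

lemma epsRight_rTensor {B' : Type} [AddCommGroup B'] [Module k B'] (F : B →ₗ[k] B') (h : H)
    (t : B ⊗[k] H) : epsRight W h (LinearMap.rTensor H F t) = F (epsRight W h t) := by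
  induction t with
  | zero => simp
  | tmul b g => simp
  | add u v hu hv => simpa using congrArg₂ (· + ·) hu hv

lemma epsLeft_rTensor {B' : Type} [AddCommGroup B'] [Module k B'] (F : B →ₗ[k] B') (h : H)
    (t : B ⊗[k] H) : epsLeft W h (LinearMap.rTensor H F t) = F (epsLeft W h t) := by
  induction t with
  | zero => simp
  | tmul b g => simp
  | add u v hu hv => simpa using congrArg₂ (· + ·) hu hv

lemma epsRight_assoc_symm_lTensor (h : H) (t : B ⊗[k] H) :
    epsRight W h ((TensorProduct.assoc k B H H).symm (LinearMap.lTensor B W.δ t)) =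
      LinearMap.lTensor B (epsRight W h ∘ₗ W.δ) t := by
  induction t with
  | zero => simp
  | add u v hu hv => simpa using congrArg₂ (· + ·) hu hv
  | tmul b g =>
    simp only [LinearMap.lTensor_tmul, LinearMap.comp_apply]
    induction W.δ g with
    | zero => simp
    | add u v hu hv => simpa [TensorProduct.tmul_add] using congrArg₂ (· + ·) hu hv
    | tmul x y => simp

lemma epsLeft_assoc_symm_lTensor (h : H) (t : B ⊗[k] H) :
    epsLeft W h ((TensorProduct.assoc k B H H).symm (LinearMap.lTensor B W.δ t)) =
      LinearMap.lTensor B (epsLeft W h ∘ₗ W.δ) t := by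
  induction t with
  | zero => simp
  | add u v hu hv => simpa using congrArg₂ (· + ·) hu hv
  | tmul b g =>
    simp only [LinearMap.lTensor_tmul, LinearMap.comp_apply]
    induction W.δ g with
    | zero => simp
    | add u v hu hv => simpa [TensorProduct.tmul_add] using congrArg₂ (· + ·) hu hv
    | tmul x y => simp

variable {W}

lemma IsWeakHopf.counit_mul_mul (hW : IsWeakHopf W) (x y z : H) :
    W.ε (x * y * z) = W.ε (x * epsRight W z (W.δ y)) := by
  rw [hW.a2]
  induction W.δ y with
  | zero => simp
  | tmul a b => simp [mul_comm]
  | add u v hu hv => simpa [mul_add] using congrArg₂ (· + ·) hu hv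

lemma IsWeakHopf.counit_mul_mul' (hW : IsWeakHopf W) (x y z : H) :
    W.ε (x * y * z) = W.ε (epsLeft W x (W.δ y) * z) := by
  rw [hW.a2']
  induction W.δ y with
  | zero => simp
  | tmul a b => simp
  | add u v hu hv => simpa [add_mul] using congrArg₂ (· + ·) hu hv

lemma epsRight_mul (hW : IsWeakHopf W) (x y : H) (t : B ⊗[k] H) :
    epsRight W (x * y) t = epsRight W (epsRight W y (W.δ x)) t := by
  induction t with
  | zero => simp
  | tmul b g => simp [← mul_assoc, hW.counit_mul_mul g x y]
  | add u v hu hv => simpa using congrArg₂ (· + ·) hu hv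

lemma epsLeft_mul (hW : IsWeakHopf W) (x y : H) (t : B ⊗[k] H) :
    epsLeft W (x * y) t = epsLeft W (epsLeft W x (W.δ y)) t := by
  induction t with
  | zero => simp
  | tmul b g => simp [hW.counit_mul_mul' x y g]
  | add u v hu hv => simpa using congrArg₂ (· + ·) hu hv

lemma epsRight_mul_tensor (hW : IsWeakHopf W) (h : H) (u v : A ⊗[k] H) :
    epsRight W h (u * v) =
      epsRight W 1 (u * LinearMap.lTensor A (epsRight W h ∘ₗ W.δ) v) := by
  induction u with
  | zero => simp
  | add u u' hu hu' => simpa [add_mul] using congrArg₂ (· + ·) hu hu'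
  | tmul a x =>
    induction v with
    | zero => simp
    | add u v hu hv => simpa [mul_add] using congrArg₂ (· + ·) hu hv
    | tmul b y => simp [hW.counit_mul_mul x y h]

lemma epsLeft_mul_tensor (hW : IsWeakHopf W) (h : H) (u v : A ⊗[k] H) :
    epsLeft W h (u * v) =
      epsLeft W 1 (LinearMap.lTensor A (epsLeft W h ∘ₗ W.δ) u * v) := by
  induction u with
  | zero => simp
  | add u u' hu hu' => simpa [add_mul] using congrArg₂ (· + ·) hu hu'
  | tmul a x =>
    induction v with
    | zero => simp
    | add u v hu hv => simpa [mul_add] using congrArg₂ (· + ·) hu hv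
    | tmul b y => simp [← mul_assoc, hW.counit_mul_mul' h x y]

variable (W)

lemma epsRight_mul_tmul_one (h : H) (t : A ⊗[k] H) (b : A) :
    epsRight W h (t * (b ⊗ₜ[k] (1 : H))) = epsRight W h t * b := by
  induction t with
  | zero => simp
  | tmul a g => simp
  | add u v hu hv => simpa [add_mul] using congrArg₂ (· + ·) hu hv

lemma epsLeft_tmul_one_mul (h : H) (t : A ⊗[k] H) (b : A) :
    epsLeft W h ((b ⊗ₜ[k] (1 : H)) * t) = b * epsLeft W h t := by
  induction t with
  | zero => simp
  | tmul a g => simp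
  | add u v hu hv => simpa [mul_add] using congrArg₂ (· + ·) hu hv

lemma mul'_lTensor_eGen (s t : A ⊗[k] H) :
    LinearMap.mul' k A (LinearMap.lTensor A (eGen W s) t) = epsRight W 1 (t * s) := by
  induction t with
  | zero => simp
  | add u v hu hv => simpa [add_mul] using congrArg₂ (· + ·) hu hv
  | tmul a x =>
    simp only [LinearMap.lTensor_tmul, LinearMap.mul'_apply, eGen_apply]
    induction s with
    | zero => simp
    | add u v hu hv => simpa [mul_add] using congrArg₂ (· + ·) hu hv
    | tmul b y => simp

lemma epsRight_one (t : B ⊗[k] H) :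
    epsRight W 1 t = TensorProduct.rid k B (LinearMap.lTensor B W.ε t) := by
  induction t with
  | zero => simp
  | tmul b g => simp
  | add u v hu hv => simpa using congrArg₂ (· + ·) hu hv

lemma epsLeft_one (t : B ⊗[k] H) :
    epsLeft W 1 t = TensorProduct.rid k B (LinearMap.lTensor B W.ε t) := by
  induction t with
  | zero => simp
  | tmul b g => simp
  | add u v hu hv => simpa using congrArg₂ (· + ·) hu hv

end Contraction

section Comodule

variable {k H A : Type} [CommRing k] [Ring H] [Algebra k H] [Ring A] [Algebra k A]
  {W : HopfData k H} {ρ : A →ₗ[k] A ⊗[k] H}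

lemma IsComodAlg.rTensor_coact (hρ : IsComodAlg W ρ) (a : A) :
    LinearMap.rTensor H ρ (ρ a) =
      (TensorProduct.assoc k A H H).symm (LinearMap.lTensor A W.δ (ρ a)) := by
  rw [← hρ.coassoc, LinearEquiv.symm_apply_apply]

lemma IsComodAlg.epsRight_one_coact (hρ : IsComodAlg W ρ) (a : A) :
    epsRight W 1 (ρ a) = a := by
  rw [epsRight_one, hρ.counit]

lemma IsComodAlg.epsLeft_one_coact (hρ : IsComodAlg W ρ) (a : A) :
    epsLeft W 1 (ρ a) = a := by
  rw [epsLeft_one, hρ.counit]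

lemma IsComodAlg.coact_epsRight (hρ : IsComodAlg W ρ) (h : H) (a : A) :
    ρ (epsRight W h (ρ a)) = LinearMap.lTensor A (epsRight W h ∘ₗ W.δ) (ρ a) := by
  rw [← epsRight_rTensor, hρ.rTensor_coact, epsRight_assoc_symm_lTensor]

lemma IsComodAlg.coact_epsLeft (hρ : IsComodAlg W ρ) (h : H) (a : A) :
    ρ (epsLeft W h (ρ a)) = LinearMap.lTensor A (epsLeft W h ∘ₗ W.δ) (ρ a) := by
  rw [← epsLeft_rTensor, hρ.rTensor_coact, epsLeft_assoc_symm_lTensor]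

lemma IsComodAlg.mul_dGen (hW : IsWeakHopf W) (hρ : IsComodAlg W ρ) (a : A) (h : H) :
    a * dGen W (ρ 1) h = epsRight W h (ρ a) := by
  conv_rhs => rw [← mul_one a, hρ.mul_compat, epsRight_mul_tensor hW, ← hρ.coact_epsRight,
    ← hρ.mul_compat, hρ.epsRight_one_coact]
  rw [dGen_apply]

lemma IsComodAlg.eGen_mul (hW : IsWeakHopf W) (hρ : IsComodAlg W ρ) (a : A) (h : H) :
    eGen W (ρ 1) h * a = epsLeft W h (ρ a) := by
  conv_rhs => rw [← one_mul a, hρ.mul_compat, epsLeft_mul_tensor hW, ← hρ.coact_epsLeft,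
    ← hρ.mul_compat, hρ.epsLeft_one_coact]
  rw [eGen_apply]

lemma IsComodAlg.mul'_lTensor_eGen_coact (hρ : IsComodAlg W ρ) (a : A) :
    LinearMap.mul' k A (LinearMap.lTensor A (eGen W (ρ 1)) (ρ a)) = a := by
  rw [mul'_lTensor_eGen, ← hρ.mul_compat, mul_one, hρ.epsRight_one_coact]

/-- A coinvariant element commutes with the values of `d_A`. -/
lemma IsCoinv.mul_dGen (hW : IsWeakHopf W) (hρ : IsComodAlg W ρ) {b : A} (hb : IsCoinv ρ b)
    (h : H) : b * dGen W (ρ 1) h = dGen W (ρ 1) h * b := by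
  rw [hρ.mul_dGen hW, hb, zeta, epsRight_mul_tmul_one, dGen_apply]

/-- `1₍₁₎ ε(1₍₂₎ 1'₍₁₎) ⊗ 1'₍₂₎ = 1₍₁₎ ⊗ 1₍₂₎`. -/
lemma IsWeakHopf.rTensor_dGen_comul_one (hW : IsWeakHopf W) :
    LinearMap.rTensor H (dGen W (W.δ 1)) (W.δ 1) = W.δ 1 := by
  have h1 : ∀ t s : H ⊗[k] H,
      LinearMap.lTensor H ((TensorProduct.lid k H).toLinearMap ∘ₗ LinearMap.rTensor H W.ε)
        ((TensorProduct.map LinearMap.id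
          (Algebra.TensorProduct.includeLeft : H →ₐ[k] H ⊗[k] H).toLinearMap) t *
        (Algebra.TensorProduct.includeRight :
          (H ⊗[k] H) →ₐ[k] H ⊗[k] (H ⊗[k] H)).toLinearMap s) =
        LinearMap.rTensor H (dGen W t) s := by
    intro t s
    induction s with
    | zero => simp
    | add u v hu hv => simpa [mul_add, TensorProduct.tmul_add] using congrArg₂ (· + ·) hu hv
    | tmul x y =>
      simp only [LinearMap.rTensor_tmul, dGen_apply]
      induction t with
      | zero => simp
      | add u v hu hv =>
        simpa [add_mul, TensorProduct.add_tmul] using congrArg₂ (· + ·) hu hv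
      | tmul a b => simp [TensorProduct.smul_tmul]
  have h2 : LinearMap.lTensor H ((TensorProduct.lid k H).toLinearMap ∘ₗ LinearMap.rTensor H W.ε)
      (LinearMap.lTensor H W.δ (W.δ 1)) = W.δ 1 := by
    rw [← LinearMap.comp_apply, ← LinearMap.lTensor_comp]
    have : ((TensorProduct.lid k H).toLinearMap ∘ₗ LinearMap.rTensor H W.ε) ∘ₗ W.δ =
        LinearMap.id := LinearMap.ext hW.counit_left
    rw [this]
    simp
  rw [← h1, ← hW.a3, hW.coassoc, h2]

variable {f : H →ₗ[k] A}

lemma IsIntegral.coact_one (hf : IsIntegral W ρ f) (htot : f 1 = 1) :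
    ρ 1 = LinearMap.rTensor H f (W.δ 1) := by
  rw [← htot, hf]

lemma IsIntegral.dGen_eq (hf : IsIntegral W ρ f) (htot : f 1 = 1) :
    dGen W (ρ 1) = f ∘ₗ dGen W (W.δ 1) := by
  ext h
  rw [LinearMap.comp_apply, dGen_apply, dGen_apply, hf.coact_one htot, epsRight_rTensor]

lemma IsIntegral.coact_one' (hW : IsWeakHopf W) (hf : IsIntegral W ρ f) (htot : f 1 = 1) :
    LinearMap.rTensor H (dGen W (ρ 1)) (W.δ 1) = ρ 1 := by
  rw [hf.dGen_eq htot, LinearMap.rTensor_comp, LinearMap.comp_apply,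
    hW.rTensor_dGen_comul_one, hf.coact_one htot]

lemma rTensor_dGen_mul_comm (hW : IsWeakHopf W) (hρ : IsComodAlg W ρ) {b : A}
    (hb : IsCoinv ρ b) (t : H ⊗[k] H) :
    (b ⊗ₜ[k] (1 : H)) * LinearMap.rTensor H (dGen W (ρ 1)) t =
      LinearMap.rTensor H (dGen W (ρ 1)) t * (b ⊗ₜ[k] (1 : H)) := by
  induction t with
  | zero => simp
  | add u v hu hv => simpa [add_mul, mul_add] using congrArg₂ (· + ·) hu hv
  | tmul x y => simp [hb.mul_dGen hW hρ]

lemma IsCoinv.tmul_one_mul_coact_one (hW : IsWeakHopf W) (hρ : IsComodAlg W ρ)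
    (hf : IsIntegral W ρ f) (htot : f 1 = 1) {b : A} (hb : IsCoinv ρ b) :
    (b ⊗ₜ[k] (1 : H)) * ρ 1 = ρ b := by
  rw [hb, zeta, ← hf.coact_one' hW htot, rTensor_dGen_mul_comm hW hρ hb]

lemma IsCoinv.coact_mul (hW : IsWeakHopf W) (hρ : IsComodAlg W ρ)
    (hf : IsIntegral W ρ f) (htot : f 1 = 1) {b : A} (hb : IsCoinv ρ b) (a : A) :
    ρ (b * a) = (b ⊗ₜ[k] (1 : H)) * ρ a := by
  rw [hρ.mul_compat, ← hb.tmul_one_mul_coact_one hW hρ hf htot, mul_assoc, ← hρ.mul_compat,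
    one_mul]

/-- A coinvariant element commutes with the values of `e_A`. -/
lemma IsCoinv.eGen_mul (hW : IsWeakHopf W) (hρ : IsComodAlg W ρ)
    (hf : IsIntegral W ρ f) (htot : f 1 = 1) {b : A} (hb : IsCoinv ρ b) (h : H) :
    eGen W (ρ 1) h * b = b * eGen W (ρ 1) h := by
  rw [hρ.eGen_mul hW, ← hb.tmul_one_mul_coact_one hW hρ hf htot, epsLeft_tmul_one_mul,
    eGen_apply]

end Comodule

section Cleft

open Coalgebra WithConv

variable {k H A : Type} [CommRing k] [Ring H] [Algebra k H] [Ring A] [Algebra k A]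
  {W : HopfData k H} {ρ : A →ₗ[k] A ⊗[k] H} {f finv : H →ₗ[k] A}

/-- The coalgebra underlying a weak Hopf algebra. -/
@[reducible]
def IsWeakHopf.coalgebra (hW : IsWeakHopf W) : Coalgebra k H where
  comul := W.δ
  counit := W.ε
  coassoc := LinearMap.ext hW.coassoc
  rTensor_counit_comp_comul := LinearMap.ext fun h ↦
    (TensorProduct.lid k H).injective (by simpa using hW.counit_left h)
  lTensor_counit_comp_comul := LinearMap.ext fun h ↦
    (TensorProduct.rid k H).injective (by simpa using hW.counit_right h)

lemma mul'_lTensor_rTensor (G K : H →ₗ[k] A) (t : H ⊗[k] H) :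
    LinearMap.mul' k A (LinearMap.lTensor A K (LinearMap.rTensor H G t)) =
      LinearMap.mul' k A (TensorProduct.map G K t) := by
  rw [← LinearMap.comp_apply (LinearMap.lTensor A K), LinearMap.lTensor_comp_rTensor]

lemma PiL_eq_dGen (hcc : Cocomm W) : PiL W = dGen W (W.δ 1) := by
  ext h
  have key (t : H ⊗[k] H) : ((TensorProduct.rid k H).toLinearMap
      ∘ₗ LinearMap.lTensor H (W.ε ∘ₗ LinearMap.mul' k H)
      ∘ₗ (TensorProduct.assoc k H H H).toLinearMap
      ∘ₗ LinearMap.rTensor H (TensorProduct.comm k H H).toLinearMap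
      ∘ₗ TensorProduct.mk k (H ⊗[k] H) H t) h = epsRight W h (TensorProduct.comm k H H t) := by
    induction t with
    | zero => simp
    | add u v hu hv => simpa [TensorProduct.add_tmul] using congrArg₂ (· + ·) hu hv
    | tmul x y => simp
  rw [dGen_apply, ← hcc 1, ← key, PiL]

variable [Coalgebra k H]

lemma pull_fstP_mul_pull_mul'_one_apply (hδ : W.δ = comul) (hε : W.ε = counit)
    (G : WithConv (H →ₗ[k] A)) (x y : H) :
    (pull (fstP H H) G * pull (LinearMap.mul' k H) 1).ofConv (x ⊗ₜ[k] y) =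
      G.ofConv (epsRight W y (W.δ x)) := by
  rw [pull_fstP_mul_apply, hδ]
  induction comul (R := k) x with
  | zero => simp
  | add u v hu hv => simpa using congrArg₂ (· + ·) hu hv
  | tmul a b =>
    simp only [TensorProduct.map_tmul, LinearMap.mul'_apply, LinearMap.comp_apply,
      LinearMap.flip_apply, TensorProduct.mk_apply, pull_apply, LinearMap.convOne_apply,
      epsRight_tmul, map_smul, hε]
    rw [Algebra.smul_def, Algebra.commutes]

lemma pull_mul'_one_mul_pull_sndP_apply [IsCocomm k H] (hδ : W.δ = comul) (hε : W.ε = counit)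
    (G : WithConv (H →ₗ[k] A)) (x y : H) :
    (pull (LinearMap.mul' k H) 1 * pull (sndP H H) G).ofConv (x ⊗ₜ[k] y) =
      G.ofConv (epsLeft W x (W.δ y)) := by
  rw [mul_pull_sndP_apply, hδ, ← comm_comul k y]
  nth_rw 2 [comm_comul k y]
  induction comul (R := k) y with
  | zero => simp
  | add u v hu hv => simpa using congrArg₂ (· + ·) hu hv
  | tmul a b =>
    simp only [TensorProduct.comm_tmul, TensorProduct.map_tmul, LinearMap.mul'_apply,
      LinearMap.comp_apply, TensorProduct.mk_apply, pull_apply, LinearMap.convOne_apply,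
      epsLeft_tmul, map_smul, hε]
    rw [Algebra.smul_def]

lemma IsCleaving.cleftRel [IsCocomm k H] (hδ : W.δ = comul) (hε : W.ε = counit)
    (hW : IsWeakHopf W) (hρ : IsComodAlg W ρ) (hf : IsCleaving W ρ f finv) :
    CleftRel (toConv f) (toConv finv) (toConv (dGen W (ρ 1))) (toConv (eGen W (ρ 1))) := by
  obtain ⟨hcolin, ⟨hinv₁, hinv₂, hinv₃⟩, -⟩ := hf
  have hconv (a b : H →ₗ[k] A) : conv k W.δ a b = (toConv a * toConv b).ofConv := by
    rw [hδ]; rfl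
  rw [hconv] at hinv₁ hinv₂
  rw [hconv, hconv, hinv₁] at hinv₃
  have hρf (x : H) : ρ (f x) = LinearMap.rTensor H f (W.δ x) := hcolin x
  refine ⟨?_, WithConv.ext hinv₂, WithConv.ext hinv₁, WithConv.ext hinv₃, ?_, ?_, ?_, ?_, ?_⟩
  · refine TensorProduct.ext' fun x y ↦ ?_
    have h1 := hW.a1 x y
    rw [hδ] at h1
    simp only [LinearMap.comp_apply, LinearMap.mul'_apply, h1, TensorProduct.comul_tmul]
    induction comul (R := k) x with
    | zero => simp
    | add u v hu hv =>
      simpa [TensorProduct.add_tmul, add_mul] using congrArg₂ (· + ·) hu hv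
    | tmul x₁ x₂ =>
      induction comul (R := k) y with
      | zero => simp
      | add u v hu hv =>
        simpa [TensorProduct.tmul_add, mul_add] using congrArg₂ (· + ·) hu hv
      | tmul y₁ y₂ => simp
  · apply WithConv.ext
    ext h
    have h1 := hρ.mul'_lTensor_eGen_coact (f h)
    rwa [hρf, mul'_lTensor_rTensor, hδ] at h1
  · apply WithConv.ext
    refine TensorProduct.ext' fun x y ↦ ?_
    rw [pull_fstP_mul_pull_sndP_apply, ← pull_one_mul_comm,
      pull_fstP_mul_pull_mul'_one_apply hδ hε]
    change f x * dGen W (ρ 1) y = f _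
    rw [hρ.mul_dGen hW, hρf, epsRight_rTensor]
  · apply WithConv.ext
    refine TensorProduct.ext' fun x y ↦ ?_
    rw [← pull_one_mul_comm, pull_fstP_mul_pull_mul'_one_apply hδ hε]
    change dGen W (ρ 1) (x * y) = dGen W (ρ 1) _
    rw [dGen_apply, dGen_apply, epsRight_mul hW]
  · apply WithConv.ext
    refine TensorProduct.ext' fun x y ↦ ?_
    rw [pull_mul'_one_mul_pull_sndP_apply hδ hε]
    change eGen W (ρ 1) (x * y) = eGen W (ρ 1) _
    rw [eGen_apply, eGen_apply, epsLeft_mul hW]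
  · apply WithConv.ext
    refine TensorProduct.ext' fun x y ↦ ?_
    rw [pull_fstP_mul_pull_sndP_apply, pull_mul'_one_mul_pull_sndP_apply hδ hε]
    change eGen W (ρ 1) x * f y = f _
    rw [hρ.eGen_mul hW, hρf, epsLeft_rTensor]

lemma pull_cst {C C' : Type} [AddCommGroup C] [Module k C] [Coalgebra k C]
    [AddCommGroup C'] [Module k C'] [Coalgebra k C'] (m : C →ₗ[k] C') (a : A) :
    pull m (cst C' a) = pull m 1 * cst C a := by
  apply WithConv.ext
  ext c
  rw [mul_cst_apply]
  simp [Algebra.smul_def]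

lemma pull_fstP_one {C C' : Type} [AddCommGroup C] [Module k C] [Coalgebra k C]
    [AddCommGroup C'] [Module k C'] [Coalgebra k C'] :
    pull (fstP C C') (1 : WithConv (C →ₗ[k] A)) = 1 := by
  apply WithConv.ext
  ext x y
  simp
  rw [Algebra.smul_def, Algebra.commutes]

lemma pull_sndP_one {C C' : Type} [AddCommGroup C] [Module k C] [Coalgebra k C]
    [AddCommGroup C'] [Module k C'] [Coalgebra k C'] :
    pull (sndP C C') (1 : WithConv (C' →ₗ[k] A)) = 1 := by
  apply WithConv.ext
  ext x y
  simp
  rw [Algebra.smul_def, Algebra.commutes]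

lemma cst_mul_comm {C : Type} [AddCommGroup C] [Module k C] [Coalgebra k C]
    {G : WithConv (C →ₗ[k] A)} {a : A} (h : ∀ c, G.ofConv c * a = a * G.ofConv c) :
    G * cst C a = cst C a * G := by
  apply WithConv.ext
  ext c
  rw [mul_cst_apply, cst_mul_apply, h]

lemma cst_mul_cst {C : Type} [AddCommGroup C] [Module k C] [Coalgebra k C] (a b : A) :
    cst (k := k) C a * cst C b = cst C (a * b) := by
  apply WithConv.ext
  ext c
  rw [cst_mul_apply]
  simp

lemma cst_one {C : Type} [AddCommGroup C] [Module k C] [Coalgebra k C] :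
    cst (k := k) C (1 : A) = 1 := by
  apply WithConv.ext
  ext c
  simp [Algebra.smul_def]

lemma pull_sndP_mul_pull_fstP_apply {C C' : Type} [AddCommGroup C] [Module k C] [Coalgebra k C]
    [AddCommGroup C'] [Module k C'] [Coalgebra k C']
    (G : WithConv (C' →ₗ[k] A)) (K : WithConv (C →ₗ[k] A)) (x : C) (y : C') :
    (pull (sndP C C') G * pull (fstP C C') K).ofConv (x ⊗ₜ[k] y) = G.ofConv y * K.ofConv x := by
  have hx := sum_counit_smul (ℛ k x)
  have hy := sum_smul_counit (k := k) y
  rw [LinearMap.convMul_apply, TensorProduct.comul_tmul]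
  conv_rhs => rw [← hx, ← hy]
  rw [← (ℛ k x).eq, ← (ℛ k y).eq]
  simp only [TensorProduct.sum_tmul, TensorProduct.tmul_sum, map_sum,
    TensorProduct.AlgebraTensorModule.tensorTensorTensorComm_tmul,
    TensorProduct.map_tmul, LinearMap.mul'_apply,
    pull_apply, fstP_tmul, sndP_tmul, map_smul, Finset.sum_mul, Finset.mul_sum]
  rw [Finset.sum_comm]
  refine Finset.sum_congr rfl fun i _ ↦ Finset.sum_congr rfl fun l _ ↦ ?_
  simp only [smul_mul_assoc, mul_smul_comm]
  exact smul_comm _ _ _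

/-- `(x, w) ↦ f(x₍₁₎) b(w) g(x₍₂₎)` as a convolution product. -/
lemma conj_apply {C C' : Type} [AddCommGroup C] [Module k C] [Coalgebra k C]
    [AddCommGroup C'] [Module k C'] [Coalgebra k C']
    (F G : WithConv (C →ₗ[k] A)) (N : WithConv (C' →ₗ[k] A)) (x : C) (w : C') :
    (pull (fstP C C') F * pull (sndP C C') N * pull (fstP C C') G).ofConv (x ⊗ₜ[k] w) =
      (F * cst C (N.ofConv w) * G).ofConv x := by
  rw [mul_assoc, mul_assoc, pull_fstP_mul_apply, LinearMap.convMul_apply]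
  congr 3
  ext c
  change (pull (sndP C C') N * pull (fstP C C') G).ofConv (c ⊗ₜ[k] w) = _
  rw [pull_sndP_mul_pull_fstP_apply, cst_mul_apply]

lemma phiAmb_apply {D : Type} [Ring D] [Algebra k D] (hδ : W.δ = comul) (j : D →ₗ[k] A)
    (h : H) (b : D) :
    phiAmb W (LinearMap.mul' k A) f finv j (h ⊗ₜ[k] b) =
      (toConv f * cst H (j b) * toConv finv).ofConv h := by
  rw [mul_assoc, LinearMap.convMul_apply, phiAmb, LinearMap.comp_apply, TensorProduct.map_tmul,
    LinearMap.comp_apply, hδ]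
  induction comul (R := k) h with
  | zero => simp
  | add u v hu hv => simpa [TensorProduct.add_tmul] using congrArg₂ (· + ·) hu hv
  | tmul x y => simp [mulSwizG, cst_mul_apply, -LinearMap.convMul_apply]

lemma conj_apply_eq_coact (hδ : W.δ = comul) (hf : IsIntegral W ρ f) (h : H) (b : A) :
    (toConv f * cst H b * toConv finv).ofConv h =
      LinearMap.mul' k A (LinearMap.lTensor A finv (ρ (f h) * (b ⊗ₜ[k] (1 : H)))) := by
  rw [LinearMap.convMul_apply, hf, hδ]
  induction comul (R := k) h with
  | zero => simp
  | add u v hu hv => simpa [add_mul] using congrArg₂ (· + ·) hu hv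
  | tmul x y => simp [mul_cst_apply, -LinearMap.convMul_apply]

end Cleft

section CleftAction

open Coalgebra WithConv

variable {k H A D : Type} [CommRing k] [Ring H] [Algebra k H] [Ring A] [Algebra k A]
  [Ring D] [Algebra k D] [Coalgebra k H]
  {W : HopfData k H} {ρ : A →ₗ[k] A ⊗[k] H} {f finv : H →ₗ[k] A} {j : D →ₐ[k] A}
  {φ : H ⊗[k] D →ₗ[k] D}

/-- A cleft extension with total cleaving morphism `f` and induced weak action `φ` on the
coinvariants `j : D → A`. -/
structure IsCleftAction (W : HopfData k H) (ρ : A →ₗ[k] A ⊗[k] H) (f finv : H →ₗ[k] A)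
    (j : D →ₐ[k] A) (φ : H ⊗[k] D →ₗ[k] D) : Prop where
  comul_eq : W.δ = comul
  counit_eq : W.ε = counit
  weakHopf : IsWeakHopf W
  cocomm : Cocomm W
  comodAlg : IsComodAlg W ρ
  cleaving : IsCleaving W ρ f finv
  total : f 1 = 1
  pres : IsCoinvPres ρ j
  action : j.toLinearMap ∘ₗ φ = phiAmb W (LinearMap.mul' k A) f finv j.toLinearMap

/-- The map `q_A = μ_A ∘ (A ⊗ f⁻¹) ∘ ρ_A`. -/
def qMap (ρ : A →ₗ[k] A ⊗[k] H) (finv : H →ₗ[k] A) : A →ₗ[k] A :=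
  LinearMap.mul' k A ∘ₗ LinearMap.lTensor A finv ∘ₗ ρ

lemma toConv_comp_conv {C : Type} [AddCommGroup C] [Module k C] [Coalgebra k C]
    (j : D →ₐ[k] A) (a b : C →ₗ[k] D) :
    toConv (j.toLinearMap ∘ₗ conv k comul a b) =
      toConv (j.toLinearMap ∘ₗ a) * toConv (j.toLinearMap ∘ₗ b) := by
  apply WithConv.ext
  ext c
  change j (LinearMap.mul' k D (TensorProduct.map a b (comul c))) =
    LinearMap.mul' k A (TensorProduct.map (j.toLinearMap ∘ₗ a) (j.toLinearMap ∘ₗ b) (comul c))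
  induction comul (R := k) c with
  | zero => simp
  | add u v hu hv => simpa using congrArg₂ (· + ·) hu hv
  | tmul x y => simp

namespace IsCleftAction

lemma coinv (h : IsCleftAction W ρ f finv j φ) (b : D) : IsCoinv ρ (j b) :=
  (h.pres.2 _).2 ⟨b, rfl⟩

lemma j_injective (h : IsCleftAction W ρ f finv j φ) : Function.Injective j := h.pres.1

lemma j_phi (h : IsCleftAction W ρ f finv j φ) (x : H) (b : D) :
    j (φ (x ⊗ₜ[k] b)) = (toConv f * cst H (j b) * toConv finv).ofConv x := by
  have h1 := congr($(h.action) (x ⊗ₜ[k] b))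
  rwa [phiAmb_apply h.comul_eq] at h1

lemma conv_inv (h : IsCleftAction W ρ f finv j φ) :
    toConv f * toConv finv = toConv (dGen W (ρ 1)) := by
  have h1 := h.cleaving.2.1.2.1
  rw [h.comul_eq] at h1
  exact WithConv.ext h1

lemma j_u1 (h : IsCleftAction W ρ f finv j φ) (x : H) : j (u1 φ x) = dGen W (ρ 1) x := by
  change j (φ (x ⊗ₜ[k] 1)) = _
  rw [h.j_phi, map_one, cst_one, mul_one, h.conv_inv]

lemma eGen_mul_cst (h : IsCleftAction W ρ f finv j φ) (b : D) :
    toConv (eGen W (ρ 1)) * cst H (j b) = cst H (j b) * toConv (eGen W (ρ 1)) :=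
  cst_mul_comm ((h.coinv b).eGen_mul h.weakHopf h.comodAlg h.cleaving.1 h.total)

lemma qMap_coinv_mul (h : IsCleftAction W ρ f finv j φ) {b : A} (hb : IsCoinv ρ b) (a : A) :
    qMap ρ finv (b * a) = b * qMap ρ finv a := by
  simp only [qMap, LinearMap.comp_apply,
    hb.coact_mul h.weakHopf h.comodAlg h.cleaving.1 h.total]
  induction ρ a with
  | zero => simp
  | add u v hu hv => simpa [mul_add] using congrArg₂ (· + ·) hu hv
  | tmul x y => simp [mul_assoc]

lemma qMap_integral (h : IsCleftAction W ρ f finv j φ) (x : H) :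
    qMap ρ finv (f x) = dGen W (ρ 1) x := by
  have h1 : (toConv f * toConv finv).ofConv x = dGen W (ρ 1) x := by rw [h.conv_inv]
  rw [qMap, LinearMap.comp_apply, LinearMap.comp_apply, h.cleaving.1, mul'_lTensor_rTensor,
    h.comul_eq]
  exact h1

lemma qMap_coinv (h : IsCleftAction W ρ f finv j φ) {b : A} (hb : IsCoinv ρ b) :
    qMap ρ finv b = b := by
  have h1 : qMap ρ finv 1 = 1 := by
    conv_lhs => rw [← h.total, h.qMap_integral, dGen_apply, h.comodAlg.epsRight_one_coact]
  rw [← mul_one b, h.qMap_coinv_mul hb, h1]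

/-- If `f(z)` is coinvariant, then `z` acts by left multiplication by `f(z)`. -/
lemma j_phi_of_coinv (h : IsCleftAction W ρ f finv j φ) {z : H} (hz : IsCoinv ρ (f z)) (b : D) :
    j (φ (z ⊗ₜ[k] b)) = f z * j b := by
  rw [h.j_phi, conj_apply_eq_coact h.comul_eq h.cleaving.1,
    ← hz.tmul_one_mul_coact_one h.weakHopf h.comodAlg h.cleaving.1 h.total, mul_assoc]
  have hb : ρ (j b) = ρ 1 * (j b ⊗ₜ[k] (1 : H)) := h.coinv b
  rw [← hb, ← hz.coact_mul h.weakHopf h.comodAlg h.cleaving.1 h.total]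
  change qMap ρ finv (f z * j b) = _
  rw [h.qMap_coinv_mul hz, h.qMap_coinv (h.coinv b)]

variable [IsCocomm k H]

lemma rel (h : IsCleftAction W ρ f finv j φ) :
    CleftRel (toConv f) (toConv finv) (toConv (dGen W (ρ 1))) (toConv (eGen W (ρ 1))) :=
  h.cleaving.cleftRel h.comul_eq h.counit_eq h.weakHopf h.comodAlg

lemma isWeakModAlg (h : IsCleftAction W ρ f finv j φ) : IsWeakModAlg W φ := by
  have hone : IsCoinv ρ (f 1) := by simp [h.total, IsCoinv, zeta, ← Algebra.TensorProduct.one_def]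
  refine ⟨fun b ↦ h.j_injective ?_, fun x b c ↦ h.j_injective ?_,
    fun x y ↦ h.j_injective ?_, fun x b ↦ h.j_injective ?_⟩
  · rw [h.j_phi_of_coinv hone, h.total, one_mul]
  · have h1 := congr(ofConv $(toConv_comp_conv j (φ ∘ₗ (TensorProduct.mk k H D).flip b)
      (φ ∘ₗ (TensorProduct.mk k H D).flip c)) x)
    have h2 (b : D) : toConv (j.toLinearMap ∘ₗ φ ∘ₗ (TensorProduct.mk k H D).flip b) =
        toConv f * cst H (j b) * toConv finv :=
      WithConv.ext (LinearMap.ext fun y ↦ h.j_phi y b)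
    rw [h.comul_eq]
    refine Eq.trans ?_ h1.symm
    rw [h.j_phi, h2, h2, map_mul]
    refine congrArg (fun G : WithConv (H →ₗ[k] A) ↦ G.ofConv x) ?_
    calc _ = toConv f * (cst H (j b) * cst H (j c)) * (toConv (eGen W (ρ 1)) * toConv finv) := by
          rw [h.rel.e_mul_inv, cst_mul_cst]
      _ = toConv f * cst H (j b) * ((toConv finv * toConv f) * cst H (j c)) * toConv finv := by
          rw [h.rel.inv_mul, h.eGen_mul_cst]; simp only [mul_assoc]
      _ = _ := by simp only [mul_assoc]
  · have h1 := congr(ofConv $(h.rel.mul_d) (x ⊗ₜ[k] y))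
    have hX := isComul_fstP (k := k) (C := H) (C' := H)
    rw [← h.conv_inv, hX.pull_mul, ← mul_assoc, ← h.rel.fst_mul_snd_d, conj_apply,
      h.conv_inv] at h1
    refine (h.j_u1 (x * y)).trans (h1.trans ?_)
    rw [h.j_phi]
    congr 5
    exact (h.j_u1 y).symm
  · have hz : f (PiL W x) = j (u1 φ x) := by
      rw [PiL_eq_dGen h.cocomm, h.j_u1, h.cleaving.1.dGen_eq h.total, LinearMap.comp_apply]
    have hc : IsCoinv ρ (f (PiL W x)) := hz ▸ h.coinv _
    rw [h.j_phi_of_coinv hc, hz, map_mul]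
    rfl

end IsCleftAction

end CleftAction

section CrossedSystem

open Coalgebra WithConv

variable {k H A D : Type} [CommRing k] [Ring H] [Algebra k H] [Ring A] [Algebra k A]
  [Ring D] [Algebra k D] [Coalgebra k H]
  {W : HopfData k H} {ρ : A →ₗ[k] A ⊗[k] H} {f finv : H →ₗ[k] A} {j : D →ₐ[k] A}
  {φ : H ⊗[k] D →ₗ[k] D} {σ σinv : H ⊗[k] H →ₗ[k] D}

lemma δ2_eq (hδ : W.δ = comul) : δ2 W = comul := by
  rw [δ2, hδ]
  rfl

lemma δ3_eq (hδ : W.δ = comul) : δ3 W = comul := by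
  rw [δ3, δ2_eq hδ, hδ]
  rfl

lemma toConv_cocyc (hδ : W.δ = comul) :
    toConv (conv k (δ2 W) (LinearMap.mul' k A ∘ₗ TensorProduct.map f f)
      (finv ∘ₗ LinearMap.mul' k H)) = cocyc (toConv f) (toConv finv) := by
  have h1 : toConv (LinearMap.mul' k A ∘ₗ TensorProduct.map f f) =
      pull (fstP H H) (toConv f) * pull (sndP H H) (toConv f) := by
    apply WithConv.ext
    refine TensorProduct.ext' fun x y ↦ ?_
    rw [pull_fstP_mul_pull_sndP_apply]
    rfl
  rw [cocyc, ← h1, δ2_eq hδ]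
  rfl

lemma toConv_cocycInv (hδ : W.δ = comul) :
    toConv (conv k (δ2 W) (f ∘ₗ LinearMap.mul' k H)
      (LinearMap.mul' k A ∘ₗ (TensorProduct.comm k A A).toLinearMap
        ∘ₗ TensorProduct.map finv finv)) = cocycInv (toConv f) (toConv finv) := by
  have h1 : toConv (LinearMap.mul' k A ∘ₗ (TensorProduct.comm k A A).toLinearMap
      ∘ₗ TensorProduct.map finv finv) =
      pull (sndP H H) (toConv finv) * pull (fstP H H) (toConv finv) := by
    apply WithConv.ext
    refine TensorProduct.ext' fun x y ↦ ?_
    rw [pull_sndP_mul_pull_fstP_apply]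
    rfl
  rw [cocycInv, ← h1, δ2_eq hδ]
  rfl

namespace IsCleftAction

lemma j_u2 (h : IsCleftAction W ρ f finv j φ) :
    toConv (j.toLinearMap ∘ₗ u2 φ) = pull (LinearMap.mul' k H) (toConv (dGen W (ρ 1))) :=
  WithConv.ext (LinearMap.ext fun _ ↦ h.j_u1 _)

lemma linearMap_ext {C : Type} [AddCommGroup C] [Module k C]
    (h : IsCleftAction W ρ f finv j φ) {a b : C →ₗ[k] D}
    (hab : toConv (j.toLinearMap ∘ₗ a) = toConv (j.toLinearMap ∘ₗ b)) : a = b :=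
  LinearMap.ext fun c ↦ h.j_injective congr(ofConv $hab c)

lemma toConv_phi (h : IsCleftAction W ρ f finv j φ) (b : D) :
    toConv (j.toLinearMap ∘ₗ φ ∘ₗ (TensorProduct.mk k H D).flip b) =
      toConv f * cst H (j b) * toConv finv :=
  WithConv.ext (LinearMap.ext fun y ↦ h.j_phi y b)

lemma toConv_phi_lTensor {C : Type} [AddCommGroup C] [Module k C] [Coalgebra k C]
    (h : IsCleftAction W ρ f finv j φ) (τ : C →ₗ[k] D) :
    toConv (j.toLinearMap ∘ₗ φ ∘ₗ LinearMap.lTensor H τ) =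
      pull (fstP H C) (toConv f) * pull (sndP H C) (toConv (j.toLinearMap ∘ₗ τ)) *
        pull (fstP H C) (toConv finv) := by
  apply WithConv.ext
  refine TensorProduct.ext' fun x w ↦ ?_
  rw [conj_apply]
  exact h.j_phi x (τ w)

lemma crossedG3 (h : IsCleftAction W ρ f finv j φ)
    (hσ : toConv (j.toLinearMap ∘ₗ σ) = cocyc (toConv f) (toConv finv)) :
    CrossedG3 W φ σ := by
  have hcolin : ∀ x, ρ (f x) = LinearMap.rTensor H f (W.δ x) := h.cleaving.1
  have key (x y : H) : j (σ (x ⊗ₜ[k] y)) =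
      LinearMap.mul' k A (LinearMap.lTensor A finv (ρ (f x * f y))) := by
    have h1 : j (σ (x ⊗ₜ[k] y)) = (cocyc (toConv f) (toConv finv)).ofConv (x ⊗ₜ[k] y) := by
      rw [← hσ]; rfl
    rw [h1, cocyc, LinearMap.convMul_apply, TensorProduct.comul_tmul, h.comodAlg.mul_compat,
      hcolin, hcolin, h.comul_eq]
    induction comul (R := k) x with
    | zero => simp
    | add u v hu hv =>
      simpa [TensorProduct.add_tmul, add_mul] using congrArg₂ (· + ·) hu hv
    | tmul x₁ x₂ =>
      induction comul (R := k) y with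
      | zero => simp
      | add u v hu hv =>
        simpa [TensorProduct.tmul_add, mul_add] using congrArg₂ (· + ·) hu hv
      | tmul y₁ y₂ =>
        simp [pull_fstP_mul_pull_sndP_apply, -LinearMap.convMul_apply]
  intro x
  refine ⟨h.j_injective ?_, h.j_injective ?_⟩
  · rw [key, h.total, mul_one, h.j_u1, ← h.qMap_integral]
    rfl
  · rw [key, h.total, one_mul, h.j_u1, ← h.qMap_integral]
    rfl

variable [IsCocomm k H]

lemma isRegPair2 (h : IsCleftAction W ρ f finv j φ)
    (hσ : toConv (j.toLinearMap ∘ₗ σ) = cocyc (toConv f) (toConv finv))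
    (hσinv : toConv (j.toLinearMap ∘ₗ σinv) = cocycInv (toConv f) (toConv finv)) :
    IsRegPair2 W φ σ σinv := by
  have h1 : conv k (δ2 W) σ σinv = u2 φ := h.linearMap_ext <| by
    rw [δ2_eq h.comul_eq, toConv_comp_conv, hσ, hσinv, h.j_u2, h.rel.cocyc_mul_cocycInv]
  have h2 : conv k (δ2 W) σinv σ = u2 φ := h.linearMap_ext <| by
    rw [δ2_eq h.comul_eq, toConv_comp_conv, hσ, hσinv, h.j_u2, h.rel.cocycInv_mul_cocyc]
  refine ⟨h1, h2, h.linearMap_ext ?_, h.linearMap_ext ?_⟩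
  · rw [h1, δ2_eq h.comul_eq, toConv_comp_conv, hσ, h.j_u2, h.rel.d_mul_cocyc]
  · rw [h2, δ2_eq h.comul_eq, toConv_comp_conv, hσinv, h.j_u2, h.rel.d_mul_cocycInv]

lemma crossedG1 (h : IsCleftAction W ρ f finv j φ)
    (hσ : toConv (j.toLinearMap ∘ₗ σ) = cocyc (toConv f) (toConv finv)) :
    CrossedG1 W φ σ := by
  intro x y b
  have hY := isComul_sndP (k := k) (C := H) (C' := H)
  have hM := h.rel.isComul_mul
  rw [δ2_eq h.comul_eq]
  suffices hs : conv k comul σ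
      ((φ ∘ₗ (TensorProduct.mk k H D).flip b) ∘ₗ LinearMap.mul' k H) =
      conv k comul (φ ∘ₗ LinearMap.lTensor H (φ ∘ₗ (TensorProduct.mk k H D).flip b)) σ from
    congr($hs (x ⊗ₜ[k] y))
  apply h.linearMap_ext
  have h1 : toConv (j.toLinearMap ∘ₗ
      ((φ ∘ₗ (TensorProduct.mk k H D).flip b) ∘ₗ LinearMap.mul' k H)) =
      pull (LinearMap.mul' k H) (toConv f) * cst (H ⊗[k] H) (j b) *
        pull (LinearMap.mul' k H) (toConv finv) := by
    change pull (LinearMap.mul' k H)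
      (toConv (j.toLinearMap ∘ₗ φ ∘ₗ (TensorProduct.mk k H D).flip b)) = _
    rw [h.toConv_phi, hM.pull_mul, hM.pull_mul, pull_cst, ← mul_assoc, ← hM.pull_mul, mul_one]
  have hb : pull (sndP H H) (toConv (eGen W (ρ 1))) * cst (H ⊗[k] H) (j b) =
      cst (H ⊗[k] H) (j b) * pull (sndP H H) (toConv (eGen W (ρ 1))) :=
    cst_mul_comm fun c ↦
      (h.coinv b).eGen_mul h.weakHopf h.comodAlg h.cleaving.1 h.total _
  rw [toConv_comp_conv, toConv_comp_conv, hσ, h1, h.toConv_phi_lTensor, h.toConv_phi,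
    h.rel.twisted hb, hY.pull_mul, hY.pull_mul, pull_cst, pull_sndP_one, one_mul]

lemma crossedG2 (h : IsCleftAction W ρ f finv j φ)
    (hσ : toConv (j.toLinearMap ∘ₗ σ) = cocyc (toConv f) (toConv finv)) :
    CrossedG2 W φ σ := by
  have h1 : (TensorProduct.rid k D).toLinearMap ∘ₗ TensorProduct.map σ W.ε
      ∘ₗ (TensorProduct.assoc k H H H).symm.toLinearMap = σ ∘ₗ CleftRel.fstSndP k H := by
    ext x y z
    simp [CleftRel.fstSndP, h.counit_eq]
  apply h.linearMap_ext
  rw [δ3_eq h.comul_eq, toConv_comp_conv, toConv_comp_conv, h.toConv_phi_lTensor, h1, hσ]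
  have h2 := h.rel.cocycle
  rw [← hσ] at h2 ⊢
  exact h2

lemma isCrossedSystem (h : IsCleftAction W ρ f finv j φ)
    (hσ : toConv (j.toLinearMap ∘ₗ σ) = cocyc (toConv f) (toConv finv))
    (hσinv : toConv (j.toLinearMap ∘ₗ σinv) = cocycInv (toConv f) (toConv finv)) :
    IsCrossedSystem W φ σ σinv :=
  ⟨h.isWeakModAlg, h.isRegPair2 hσ hσinv, h.crossedG1 hσ, h.crossedG2 hσ, h.crossedG3 hσ⟩

end IsCleftAction

end CrossedSystem

section CrossedProduct

open Coalgebra WithConv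

variable {k H A D : Type} [CommRing k] [Ring H] [Algebra k H] [Ring A] [Algebra k A]
  [Ring D] [Algebra k D]
  {W : HopfData k H} {ρ : A →ₗ[k] A ⊗[k] H} {f finv : H →ₗ[k] A} {j : D →ₐ[k] A}
  {φ : H ⊗[k] D →ₗ[k] D} {σ σinv : H ⊗[k] H →ₗ[k] D} {pA : A →ₗ[k] D}

/-- The map `d ⊗ h ↦ j(d) f(h)`. -/
def jMulF (j : D →ₐ[k] A) (f : H →ₗ[k] A) : D ⊗[k] H →ₗ[k] A :=
  LinearMap.mul' k A ∘ₗ TensorProduct.map j.toLinearMap f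

@[simp]
lemma jMulF_tmul (d : D) (x : H) : jMulF j f (d ⊗ₜ[k] x) = j d * f x := rfl

lemma nabla_tmul (φ : H ⊗[k] D →ₗ[k] D) (b : D) (x : H) :
    nabla W φ (b ⊗ₜ[k] x) =
      LinearMap.rTensor H (LinearMap.mulLeft k b ∘ₗ u1 φ) (W.δ x) := by
  simp only [nabla, ψmap, LinearMap.comp_apply, LinearMap.lTensor_tmul, LinearMap.flip_apply,
    TensorProduct.mk_apply, LinearMap.rTensor_tmul, LinearEquiv.coe_coe]
  induction W.δ x with
  | zero => simp
  | add u v hu hv =>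
    simpa [TensorProduct.add_tmul, TensorProduct.tmul_add] using congrArg₂ (· + ·) hu hv
  | tmul y z => simp [u1]

lemma mul'_map_qMap_coact (hρ : IsComodAlg W ρ) (a : A) :
    LinearMap.mul' k A (TensorProduct.map (qMap ρ finv) f (ρ a)) =
      LinearMap.mul' k A (LinearMap.lTensor A (conv k W.δ finv f) (ρ a)) := by
  have h1 : TensorProduct.map (qMap ρ finv) f (ρ a) =
      TensorProduct.map (LinearMap.mul' k A ∘ₗ LinearMap.lTensor A finv) f
        (LinearMap.rTensor H ρ (ρ a)) := by
    rw [LinearMap.map_rTensor]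
    rfl
  rw [h1, hρ.rTensor_coact]
  induction ρ a with
  | zero => simp
  | add u v hu hv => simpa using congrArg₂ (· + ·) hu hv
  | tmul b x =>
    simp only [LinearMap.lTensor_tmul, LinearMap.mul'_apply, conv, convG, LinearMap.comp_apply]
    induction W.δ x with
    | zero => simp
    | add u v hu hv =>
      simpa [TensorProduct.tmul_add, mul_add] using congrArg₂ (· + ·) hu hv
    | tmul y z => simp [mul_assoc]

variable [Coalgebra k H]

namespace IsCleftAction

lemma jMulF_coact (h : IsCleftAction W ρ f finv j φ)
    (hpA : j.toLinearMap ∘ₗ pA = qMap ρ finv) (a : A) :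
    jMulF j f (LinearMap.rTensor H pA (ρ a)) = a := by
  rw [jMulF, LinearMap.comp_apply, ← LinearMap.comp_apply (TensorProduct.map _ _),
    LinearMap.map_comp_rTensor, hpA, mul'_map_qMap_coact h.comodAlg, h.cleaving.2.1.1,
    h.comodAlg.mul'_lTensor_eGen_coact]

lemma coact_jMulF (h : IsCleftAction W ρ f finv j φ)
    (hpA : j.toLinearMap ∘ₗ pA = qMap ρ finv) (t : D ⊗[k] H) :
    LinearMap.rTensor H pA (ρ (jMulF j f t)) = nabla W φ t := by
  have hcolin : ∀ x, ρ (f x) = LinearMap.rTensor H f (W.δ x) := h.cleaving.1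
  induction t with
  | zero => simp
  | add u v hu hv => simpa using congrArg₂ (· + ·) hu hv
  | tmul b x =>
    have hp (y : H) : pA (j b * f y) = b * u1 φ y := h.j_injective <| by
      have h1 : j (pA (j b * f y)) = qMap ρ finv (j b * f y) := congr($hpA _)
      rw [h1, h.qMap_coinv_mul (h.coinv b), h.qMap_integral, map_mul, h.j_u1]
    rw [nabla_tmul, jMulF_tmul,
      (h.coinv b).coact_mul h.weakHopf h.comodAlg h.cleaving.1 h.total, hcolin]
    induction W.δ x with
    | zero => simp
    | add u v hu hv => simpa [mul_add] using congrArg₂ (· + ·) hu hv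
    | tmul y z => simp [hp]

lemma jMulF_σHA (h : IsCleftAction W ρ f finv j φ)
    (hσ : toConv (j.toLinearMap ∘ₗ σ) = cocyc (toConv f) (toConv finv)) (c : D)
    (w : H ⊗[k] H) :
    jMulF j f (LinearMap.rTensor H (LinearMap.mulLeft k c) (σHA W σ w)) =
      j c * (cocyc (toConv f) (toConv finv) *
        pull (LinearMap.mul' k H) (toConv f)).ofConv w := by
  rw [σHA, LinearMap.comp_apply, δ2_eq h.comul_eq, LinearMap.convMul_apply, ← hσ]
  induction comul (R := k) w with
  | zero => simp
  | add u v hu hv => simpa [mul_add] using congrArg₂ (· + ·) hu hv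
  | tmul x y => simp [mul_assoc]

lemma jMulF_crossmulAmb [IsCocomm k H] (h : IsCleftAction W ρ f finv j φ)
    (hσ : toConv (j.toLinearMap ∘ₗ σ) = cocyc (toConv f) (toConv finv)) (u v : D ⊗[k] H) :
    jMulF j f (crossmulAmb W φ σ (u ⊗ₜ[k] v)) = jMulF j f u * jMulF j f v := by
  induction u with
  | zero => simp
  | add u u' hu hu' =>
    simpa [TensorProduct.add_tmul, add_mul] using congrArg₂ (· + ·) hu hu'
  | tmul b x =>
  induction v with
  | zero => simp
  | add u u' hu hu' =>
    simpa [TensorProduct.tmul_add, mul_add] using congrArg₂ (· + ·) hu hu'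
  | tmul c y =>
    have hX := isComul_fstP (k := k) (C := H) (C' := H)
    have hc : pull (fstP H H) (toConv (eGen W (ρ 1))) * cst (H ⊗[k] H) (j c) =
        cst (H ⊗[k] H) (j c) * pull (fstP H H) (toConv (eGen W (ρ 1))) :=
      cst_mul_comm fun _ ↦
        (h.coinv c).eGen_mul h.weakHopf h.comodAlg h.cleaving.1 h.total _
    have hcst : pull (fstP H H) (cst H (j c)) = cst (H ⊗[k] H) (j c) := by
      rw [pull_cst, pull_fstP_one, one_mul]
    have h1 := h.rel.conj_mul_cocyc_mul hc
    rw [← hcst, ← hX.pull_mul, ← hX.pull_mul, mul_assoc] at h1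
    have h2 := congr(ofConv $h1 (x ⊗ₜ[k] y))
    rw [pull_fstP_mul_apply, pull_fstP_mul_pull_sndP_apply, mul_cst_apply, ← h.toConv_phi] at h2
    rw [jMulF_tmul, jMulF_tmul, mul_assoc, ← mul_assoc (f x)]
    refine Eq.trans ?_ congr(j b * $h2)
    have key (t : H ⊗[k] H) :
        jMulF j f (LinearMap.rTensor H (LinearMap.mul' k D)
          ((TensorProduct.assoc k D D H).symm (b ⊗ₜ[k]
            LinearMap.rTensor H (LinearMap.mul' k D) ((TensorProduct.assoc k D D H).symm
              (LinearMap.lTensor D (σHA W σ) (TensorProduct.assoc k D H H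
                (LinearMap.rTensor H φ ((TensorProduct.assoc k H D H).symm
                  (LinearMap.lTensor H (TensorProduct.comm k H D).toLinearMap
                    (TensorProduct.assoc k H H D (t ⊗ₜ[k] c)))) ⊗ₜ[k] y))))))) =
        j b * LinearMap.mul' k A (TensorProduct.map
          (j.toLinearMap ∘ₗ φ ∘ₗ (TensorProduct.mk k H D).flip c)
          ((cocyc (toConv f) (toConv finv) * pull (LinearMap.mul' k H) (toConv f)).ofConv ∘ₗ
            (TensorProduct.mk k H H).flip y) t) := by
      induction t with
      | zero => simp
      | add u v hu hv =>
        simpa [TensorProduct.add_tmul, TensorProduct.tmul_add, mul_add,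
          -LinearMap.convMul_apply] using congrArg₂ (· + ·) hu hv
      | tmul x₁ x₂ =>
        simp only [TensorProduct.map_tmul, LinearMap.mul'_apply, LinearMap.comp_apply,
          LinearMap.flip_apply, TensorProduct.mk_apply, AlgHom.toLinearMap_apply]
        rw [← mul_assoc, ← map_mul, ← h.jMulF_σHA hσ]
        simp only [TensorProduct.assoc_tmul, TensorProduct.comm_tmul, LinearMap.lTensor_tmul,
          LinearMap.rTensor_tmul, TensorProduct.assoc_symm_tmul, LinearEquiv.coe_coe]
        induction σHA W σ (x₂ ⊗ₜ[k] y) with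
        | zero => simp
        | add u v hu hv =>
          simpa [TensorProduct.tmul_add] using congrArg₂ (· + ·) hu hv
        | tmul s t => simp [mul_assoc]
    refine Eq.trans ?_ (key (comul x))
    rw [← h.comul_eq]
    rfl

end IsCleftAction

end CrossedProduct

/-- Let `H` be a cocommutative weak Hopf algebra and
`A_H ↪ A` an `H`-cleft extension with convolution invertible total integral
`f`.  Then the induced pair `(φ', σ')` is a crossed system for `H` over
`A_H`, and the `H`-cleft extensions `A_H ↪ A` and `A_H ↪ A_H×_{σ'}H` are
equivalent via `T = p_{A_H⊗H}∘(p_A⊗H)∘ρ_A`, where `p_A` is the factorization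
of `q_A = μ_A∘(A⊗f⁻¹)∘ρ_A` through `A_H`. -/
theorem statement15 {k H A D P : Type} [CommRing k] [Ring H] [Algebra k H]
    [Ring A] [Algebra k A] [Ring D] [Algebra k D] [AddCommGroup P] [Module k P]
    (W : HopfData k H) (hW : IsWeakHopf W) (hcc : Cocomm W)
    (ρ : A →ₗ[k] A ⊗[k] H) (hρ : IsComodAlg W ρ)
    (f finv : H →ₗ[k] A) (hf : IsCleaving W ρ f finv) (htot : f 1 = 1)
    (j : D →ₐ[k] A) (hj : IsCoinvPres ρ j)
    -- the induced weak module algebra structure `φ'` and cocycle `σ'`, `σ''`: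
    (φ' : H ⊗[k] D →ₗ[k] D)
    (hφ' : j.toLinearMap ∘ₗ φ' = phiAmb W (LinearMap.mul' k A) f finv j.toLinearMap)
    (σ' σ'' : H ⊗[k] H →ₗ[k] D)
    (hσ' : j.toLinearMap ∘ₗ σ' =
      conv k (δ2 W) (LinearMap.mul' k A ∘ₗ TensorProduct.map f f)
        (finv ∘ₗ LinearMap.mul' k H))
    (hσ'' : j.toLinearMap ∘ₗ σ'' =
      conv k (δ2 W) (f ∘ₗ LinearMap.mul' k H)
        (LinearMap.mul' k A ∘ₗ (TensorProduct.comm k A A).toLinearMap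
          ∘ₗ TensorProduct.map finv finv))
    -- `p_A` is the factorization of `q_A` through the coinvariants:
    (pA : A →ₗ[k] D)
    (hpA : j.toLinearMap ∘ₗ pA =
      LinearMap.mul' k A ∘ₗ LinearMap.lTensor A finv ∘ₗ ρ)
    -- a splitting of the idempotent `∇_{A_H⊗H}`:
    (p : D ⊗[k] H →ₗ[k] P) (ι : P →ₗ[k] D ⊗[k] H)
    (hsplit : ι ∘ₗ p = nabla W φ') (hretr : p ∘ₗ ι = LinearMap.id) :
    -- `(φ', σ')` is a crossed system for `H` over `A_H`:
    IsCrossedSystem W φ' σ' σ'' ∧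
    -- the two cleft extensions are equivalent:
    ∀ T : A →ₗ[k] P, T = p ∘ₗ LinearMap.rTensor H pA ∘ₗ ρ →
      (∀ a b : A, T (a * b) = crossMul W φ' σ' p ι (T a ⊗ₜ[k] T b)) ∧
      T (1 : A) = crossUnit W φ' p ∧
      (∀ a : A, crossCoact W p ι (T a) = (LinearMap.rTensor H T) (ρ a)) ∧
      Function.Bijective T ∧
      (∀ d : D, T (j d) = crossInc p d) := by
  let := hW.coalgebra
  have : Coalgebra.IsCocomm k H := ⟨LinearMap.ext hcc⟩
  have h : IsCleftAction W ρ f finv j φ' :=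
    ⟨rfl, rfl, hW, hcc, hρ, hf, htot, hj, hφ'⟩
  have hσ : WithConv.toConv (j.toLinearMap ∘ₗ σ') =
      cocyc (WithConv.toConv f) (WithConv.toConv finv) := by
    rw [hσ', toConv_cocyc rfl]
  have hσinv : WithConv.toConv (j.toLinearMap ∘ₗ σ'') =
      cocycInv (WithConv.toConv f) (WithConv.toConv finv) := by
    rw [hσ'', toConv_cocycInv rfl]
  refine ⟨h.isCrossedSystem hσ hσinv, ?_⟩
  rintro T rfl
  have hws := h.jMulF_coact (pA := pA) hpA
  have hsw := h.coact_jMulF (pA := pA) hpA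
  have hιp (t : D ⊗[k] H) : ι (p t) = nabla W φ' t := congr($hsplit t)
  have hpι (x : P) : p (ι x) = x := congr($hretr x)
  have hι (a : A) : ι (p (LinearMap.rTensor H pA (ρ a))) = LinearMap.rTensor H pA (ρ a) := by
    rw [hιp, ← hsw, hws]
  have hpw (t : D ⊗[k] H) : p (LinearMap.rTensor H pA (ρ (jMulF j f t))) = p t := by
    rw [hsw, ← hιp, hpι]
  simp only [LinearMap.comp_apply]
  refine ⟨fun a b ↦ ?_, ?_, fun a ↦ ?_, ⟨fun a b hab ↦ ?_, fun x ↦ ⟨jMulF j f (ι x), ?_⟩⟩,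
    fun d ↦ ?_⟩
  · rw [crossMul, LinearMap.comp_apply, LinearMap.comp_apply, TensorProduct.map_tmul, hι, hι,
      ← hpw (crossmulAmb W φ' σ' _), h.jMulF_crossmulAmb hσ, hws, hws]
  · rw [crossUnit, ← hsw, jMulF_tmul, map_one j, htot, one_mul]
  · have h1 (t : A ⊗[k] H) : (TensorProduct.assoc k D H H).symm
        (LinearMap.lTensor D W.δ (LinearMap.rTensor H pA t)) =
        LinearMap.rTensor H (LinearMap.rTensor H pA)
          ((TensorProduct.assoc k A H H).symm (LinearMap.lTensor A W.δ t)) := by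
      induction t with
      | zero => simp
      | add u v hu hv => simpa using congrArg₂ (· + ·) hu hv
      | tmul b x =>
        simp only [LinearMap.rTensor_tmul, LinearMap.lTensor_tmul]
        induction W.δ x with
        | zero => simp
        | add u v hu hv => simpa [TensorProduct.tmul_add] using congrArg₂ (· + ·) hu hv
        | tmul y z => simp
    simp only [crossCoact, LinearMap.comp_apply, LinearEquiv.coe_coe, hι, h1]
    rw [← hρ.rTensor_coact, LinearMap.rTensor_comp, LinearMap.rTensor_comp]
    rfl
  · rw [← hws a, ← hws b, ← hι a, ← hι b]
    exact congr(jMulF j f (ι $hab))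
  · exact (hpw _).trans (hpι x)
  · have h1 := hpw (d ⊗ₜ[k] 1)
    rw [jMulF_tmul, htot, mul_one] at h1
    exact h1

end WHA

end
end
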